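/- arXiv:2303.11503 — 4 statements merged into one kernel-verified Lean document; each statement's English description precedes it below -/
import Mathlib

section
/- Let n, d, t be integers with 2 ≤ d ≤ n−2 and 2 ≤ t ≤ d. Let G_{n,d,t} be the graph obtained from the disjoint union of a path P_{d+1} = v₁…v_{d+1} and a complete graph K_{n−d−1} by joining every vertex of K_{n−d−1} to each of v_{t−1}, v_t, v_{t+1}. Then the number of Laplacian eigenvalues of G_{n,d,t} in the interval [n−d+2, n] equals n−d, and μ_{n−d}(G_{n,d,t}) = n−d+2. -/
open Matrix

/-- Sorted (nonincreasing) list of eigenvalues of a matrix, empty if not Hermitian. -/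
noncomputable def heigList {𝕜 : Type} [RCLike 𝕜] {m : Type} [Fintype m] [DecidableEq m]
    (M : Matrix m m 𝕜) : List ℝ :=
  if h : M.IsHermitian then (Finset.univ.val.map h.eigenvalues).sort (· ≥ ·) else []

/-- `kthEig M k` is the k-th largest eigenvalue of `M` (1-indexed). -/
noncomputable def kthEig {𝕜 : Type} [RCLike 𝕜] {m : Type} [Fintype m] [DecidableEq m]
    (M : Matrix m m 𝕜) (k : ℕ) : ℝ :=
  (heigList M).getD (k - 1) 0

/-- Laplacian matrix of a simple graph on a finite vertex type, over ℝ. -/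
noncomputable def lapMat {V : Type} [Fintype V] [DecidableEq V] (G : SimpleGraph V) :
    Matrix V V ℝ :=
  letI := Classical.decRel G.Adj
  G.lapMatrix ℝ

/-- `lapμ G k` is the k-th largest Laplacian eigenvalue of `G` (1-indexed). -/
noncomputable def lapμ {V : Type} [Fintype V] [DecidableEq V] (G : SimpleGraph V) (k : ℕ) : ℝ :=
  kthEig (lapMat G) k

/-- Number of Laplacian eigenvalues of `G` in the closed interval `[a, b]`, with multiplicity. -/
noncomputable def mIcc {V : Type} [Fintype V] [DecidableEq V] (G : SimpleGraph V) (a b : ℝ) : ℕ :=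
  ((heigList (lapMat G)).filter (fun x => a ≤ x ∧ x ≤ b)).length

/-- The graph `G_{n,d,t}`: a path `v₁ … v_{d+1}` (vertices `0, …, d`) together with a clique on
vertices `d+1, …, n-1`, each clique vertex joined to `v_{t-1}, v_t, v_{t+1}`
(vertices `t-2, t-1, t`). -/
def Gndt (n d t : ℕ) : SimpleGraph (Fin n) :=
  SimpleGraph.fromRel (fun i j =>
    (i.val + 1 = j.val ∧ j.val ≤ d) ∨
    (d + 1 ≤ i.val ∧ d + 1 ≤ j.val) ∨
    (d + 1 ≤ i.val ∧ (j.val = t - 2 ∨ j.val = t - 1 ∨ j.val = t)))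

lemma aux_list (c : ℝ) : ∀ (l : List ℝ) (K : ℕ), l.Pairwise (· ≥ ·) → c ∈ l →
    (l.filter (fun x => c ≤ x)).length = K + 1 → l.getD K 0 = c := by
  intro l
  induction l with
  | nil => intro K _ h; simp at h
  | cons a l ih =>
    intro K hs hc hk
    rw [List.pairwise_cons] at hs
    have hac : c ≤ a := by
      rcases List.mem_cons.1 hc with h | h
      · exact h.le
      · exact hs.1 c h
    have hk' : (l.filter (fun x => c ≤ x)).length = K := by
      rw [List.filter_cons_of_pos (by simpa using hac)] at hk
      simpa using hk
    cases K with
    | zero =>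
      have h0 := List.length_eq_zero_iff.1 hk'
      rcases List.mem_cons.1 hc with h | h
      · simp [h]
      · have : c ∈ l.filter (fun x => c ≤ x) := by simp [h]
        rw [h0] at this
        simp at this
    | succ K' =>
      have : c ∈ l := by
        rcases List.mem_cons.1 hc with h | h
        · have hpos : 0 < (l.filter (fun x => c ≤ x)).length := by omega
          obtain ⟨y, hy⟩ := List.exists_mem_of_length_pos hpos
          simp only [List.mem_filter, decide_eq_true_eq] at hy
          have := hs.1 y hy.1
          have : y = c := le_antisymm (by rw [h]; exact this) hy.2
          exact this ▸ hy.1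
        · exact h
      simpa using ih K' hs.2 this hk'

section spectral
variable {m : Type} [Fintype m] [DecidableEq m] {M : Matrix m m ℝ} (hM : M.IsHermitian)

/-- coefficient in the eigenbasis -/
noncomputable def eCoef (x : m → ℝ) (i : m) : ℝ := (hM.eigenvectorBasis i).ofLp ⬝ᵥ x

lemma eCoef_parseval (x y : m → ℝ) : x ⬝ᵥ y = ∑ i, eCoef hM x i * eCoef hM y i := by
  have h := hM.eigenvectorBasis.sum_inner_mul_inner (WithLp.toLp 2 x) (WithLp.toLp 2 y)
  simp only [EuclideanSpace.inner_eq_star_dotProduct, star_trivial] at h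
  rw [dotProduct_comm x y, ← h]
  refine Finset.sum_congr rfl fun i _ => ?_
  simp only [eCoef]
  rw [dotProduct_comm y]

lemma eCoef_mulVec (x : m → ℝ) (i : m) :
    eCoef hM (M *ᵥ x) i = hM.eigenvalues i * eCoef hM x i := by
  have h := hM.mulVec_eigenvectorBasis i
  have hT : Mᵀ = M := by
    have h0 : Mᴴ = M := hM
    rwa [Matrix.conjTranspose_eq_transpose_of_trivial] at h0
  simp only [eCoef]
  rw [Matrix.dotProduct_mulVec, ← Matrix.mulVec_transpose, hT, h, smul_dotProduct, smul_eq_mul]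

lemma quad_eq (x : m → ℝ) :
    x ⬝ᵥ (M *ᵥ x) = ∑ i, hM.eigenvalues i * (eCoef hM x i)^2 := by
  rw [eCoef_parseval hM]
  refine Finset.sum_congr rfl fun i _ => ?_
  rw [eCoef_mulVec]; ring

lemma norm_eq (x : m → ℝ) : x ⬝ᵥ x = ∑ i, (eCoef hM x i)^2 := by
  rw [eCoef_parseval hM]
  refine Finset.sum_congr rfl fun i _ => ?_
  ring

/-- linear map of coefficients restricted to a finset -/
noncomputable def coefMap (s : Finset m) : (m → ℝ) →ₗ[ℝ] (s → ℝ) where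
  toFun x i := eCoef hM x i
  map_add' x y := by ext i; simp [eCoef, dotProduct_add]
  map_smul' c x := by ext i; simp [eCoef, dotProduct_smul]

lemma coef_finrank {ι : Type} [Fintype ι] (f : (ι → ℝ) →ₗ[ℝ] (m → ℝ)) (s : Finset m)
    (h : ∀ y, (∀ i ∈ s, eCoef hM (f y) i = 0) → y = 0) : Fintype.card ι ≤ s.card := by
  have hinj : Function.Injective ((coefMap hM s).comp f) := by
    rw [← LinearMap.ker_eq_bot, LinearMap.ker_eq_bot']
    intro y hy
    apply h
    intro i hi
    exact congrFun hy ⟨i, hi⟩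
  have := LinearMap.finrank_le_finrank_of_injective hinj
  simpa using this

lemma lemA {ι : Type} [Fintype ι] (f : (ι → ℝ) →ₗ[ℝ] (m → ℝ)) (c : ℝ)
    (h : ∀ y, c * (f y ⬝ᵥ f y) ≤ f y ⬝ᵥ (M *ᵥ f y) → y = 0) :
    Fintype.card ι ≤ (Finset.univ.filter (fun i => ¬ c ≤ hM.eigenvalues i)).card := by
  apply coef_finrank hM f
  intro y hy
  apply h
  rw [quad_eq hM, norm_eq hM, Finset.mul_sum]
  refine Finset.sum_le_sum fun i _ => ?_
  by_cases hi : c ≤ hM.eigenvalues i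
  · exact mul_le_mul_of_nonneg_right hi (sq_nonneg _)
  · rw [hy i (by simpa using hi)]; simp

lemma lemB {ι : Type} [Fintype ι] (f : (ι → ℝ) →ₗ[ℝ] (m → ℝ)) (c : ℝ)
    (hf : ∀ y, f y = 0 → y = 0)
    (h : ∀ y, c * (f y ⬝ᵥ f y) ≤ f y ⬝ᵥ (M *ᵥ f y)) :
    Fintype.card ι ≤ (Finset.univ.filter (fun i => c ≤ hM.eigenvalues i)).card := by
  apply coef_finrank hM f
  intro y hy
  apply hf
  have h1 := h y
  rw [quad_eq hM, norm_eq hM, Finset.mul_sum] at h1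
  have hle : ∀ i ∈ Finset.univ, hM.eigenvalues i * (eCoef hM (f y) i)^2
      ≤ c * (eCoef hM (f y) i)^2 := by
    intro i _
    by_cases hi : c ≤ hM.eigenvalues i
    · rw [hy i (by simpa using hi)]; simp
    · exact mul_le_mul_of_nonneg_right (not_le.1 hi).le (sq_nonneg _)
  have heq := (Finset.sum_eq_sum_iff_of_le hle).1 (le_antisymm (Finset.sum_le_sum hle) h1)
  have hz : ∀ i, eCoef hM (f y) i = 0 := by
    intro i
    by_cases hi : c ≤ hM.eigenvalues i
    · exact hy i (by simpa using hi)
    · have := heq i (Finset.mem_univ _)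
      have h2 : (c - hM.eigenvalues i) * (eCoef hM (f y) i)^2 = 0 := by linarith
      rcases mul_eq_zero.1 h2 with h3 | h3
      · exact absurd (by linarith) hi
      · exact pow_eq_zero_iff (two_ne_zero) |>.1 h3
  have h0 : f y ⬝ᵥ f y = 0 := by rw [norm_eq hM]; simp [hz]
  exact dotProduct_self_eq_zero.1 h0

lemma eig_exists (x : m → ℝ) (c : ℝ) (hx : x ≠ 0) (h : M *ᵥ x = c • x) :
    ∃ i, hM.eigenvalues i = c := by
  by_contra! hne
  apply hx
  apply dotProduct_self_eq_zero.1
  rw [norm_eq hM]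
  refine Finset.sum_eq_zero fun i _ => ?_
  have h1 := eCoef_mulVec hM x i
  rw [h] at h1
  have h2 : eCoef hM (c • x) i = c * eCoef hM x i := by simp [eCoef, dotProduct_smul]
  rw [h2] at h1
  have h3 : (hM.eigenvalues i - c) * eCoef hM x i = 0 := by linarith
  rcases mul_eq_zero.1 h3 with h4 | h4
  · exact absurd (by linarith) (hne i)
  · rw [h4]; simp

lemma eig_le (c : ℝ) (h : ∀ x : m → ℝ, x ⬝ᵥ (M *ᵥ x) ≤ c * (x ⬝ᵥ x)) (i : m) :
    hM.eigenvalues i ≤ c := by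
  have h1 := h (hM.eigenvectorBasis i).ofLp
  rw [hM.mulVec_eigenvectorBasis i, dotProduct_smul, smul_eq_mul] at h1
  have h2 : (hM.eigenvectorBasis i).ofLp ⬝ᵥ (hM.eigenvectorBasis i).ofLp = 1 := by
    have := hM.eigenvectorBasis.orthonormal.1 i
    have h3 := real_inner_self_eq_norm_sq (hM.eigenvectorBasis i)
    rw [this] at h3
    rw [EuclideanSpace.inner_eq_star_dotProduct, star_trivial] at h3
    rw [h3]; norm_num
  rw [h2] at h1
  linarith

end spectral

section graph
open Classical in
lemma lap_quad {V : Type} [Fintype V] [DecidableEq V] (G : SimpleGraph V) (x : V → ℝ) :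
    x ⬝ᵥ (lapMat G *ᵥ x) = (∑ i, ∑ j, if G.Adj i j then (x i - x j)^2 else 0) / 2 := by
  have := @SimpleGraph.lapMatrix_toLinearMap₂' V ℝ _ G (Classical.decRel G.Adj) _ _ _ x
  rw [Matrix.toLinearMap₂'_apply'] at this
  unfold lapMat
  rw [this]

lemma lap_herm {V : Type} [Fintype V] [DecidableEq V] (G : SimpleGraph V) :
    (lapMat G).IsHermitian := by
  have h : (lapMat G)ᵀ = lapMat G :=
    @SimpleGraph.isSymm_lapMatrix V ℝ _ G (Classical.decRel G.Adj) _ _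
  rw [Matrix.IsHermitian, Matrix.conjTranspose_eq_transpose_of_trivial, h]

open Classical in
lemma lap_mulVec {V : Type} [Fintype V] [DecidableEq V] (G : SimpleGraph V) (x : V → ℝ) (i : V) :
    (lapMat G *ᵥ x) i = ∑ j, if G.Adj i j then (x i - x j) else 0 := by
  unfold lapMat
  have h := @SimpleGraph.lapMatrix_mulVec_apply V ℝ _ G (Classical.decRel G.Adj) _ _ i x
  rw [h]
  rw [← Finset.sum_filter, Finset.sum_sub_distrib, Finset.sum_const, nsmul_eq_mul,
    ← SimpleGraph.card_neighborFinset_eq_degree, SimpleGraph.neighborFinset_eq_filter]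

lemma sq_sum_id {V : Type} [DecidableEq V] (T : Finset V) (x : V → ℝ) :
    ∑ i ∈ T, ∑ j ∈ T, (x i - x j)^2 = 2 * (T.card * ∑ i ∈ T, x i ^2 - (∑ i ∈ T, x i)^2) := by
  have : ∀ i j, (x i - x j)^2 = x i ^2 + x j ^2 - 2 * (x i * x j) := by intros; ring
  simp only [this, Finset.sum_sub_distrib, Finset.sum_add_distrib, Finset.sum_const, nsmul_eq_mul,
    ← Finset.mul_sum, ← Finset.sum_mul]
  ring

lemma lap_le {V : Type} [Fintype V] [DecidableEq V] (G : SimpleGraph V) (x : V → ℝ) :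
    x ⬝ᵥ (lapMat G *ᵥ x) ≤ Fintype.card V * (x ⬝ᵥ x) := by
  classical
  rw [lap_quad]
  have h : (∑ i, ∑ j, if G.Adj i j then (x i - x j)^2 else 0) ≤ ∑ i, ∑ j, (x i - x j)^2 := by
    refine Finset.sum_le_sum fun i _ => Finset.sum_le_sum fun j _ => ?_
    split_ifs
    · exact le_rfl
    · positivity
  rw [sq_sum_id] at h
  have h2 : x ⬝ᵥ x = ∑ i, x i ^2 := by
    simp [dotProduct, sq]
  rw [h2]
  rw [Finset.card_univ] at h
  nlinarith [sq_nonneg (∑ i, x i)]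

end graph

section main

/-- The twin class. -/
def SS (n d t : ℕ) : Finset (Fin n) := Finset.univ.filter (fun i => i.val + 1 = t ∨ d + 1 ≤ i.val)

lemma mem_SS {n d t : ℕ} (i : Fin n) : i ∈ SS n d t ↔ (i.val + 1 = t ∨ d + 1 ≤ i.val) := by
  simp [SS]

/-- Twin class with the two common path neighbours. -/
def TT (n d t : ℕ) : Finset (Fin n) :=
  Finset.univ.filter (fun i => i.val + 1 = t ∨ d + 1 ≤ i.val ∨ i.val + 2 = t ∨ i.val = t)

lemma mem_TT {n d t : ℕ} (i : Fin n) : i ∈ TT n d t ↔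
    (i.val + 1 = t ∨ d + 1 ≤ i.val ∨ i.val + 2 = t ∨ i.val = t) := by
  simp [TT]

variable {n d t : ℕ}

lemma Gadj (ht : 2 ≤ t) (i j : Fin n) : (Gndt n d t).Adj i j ↔ i.val ≠ j.val ∧
    (((i.val + 1 = j.val ∧ j.val ≤ d) ∨ (d + 1 ≤ i.val ∧ d + 1 ≤ j.val) ∨
    (d + 1 ≤ i.val ∧ (j.val + 2 = t ∨ j.val + 1 = t ∨ j.val = t))) ∨
    ((j.val + 1 = i.val ∧ i.val ≤ d) ∨ (d + 1 ≤ j.val ∧ d + 1 ≤ i.val) ∨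
    (d + 1 ≤ j.val ∧ (i.val + 2 = t ∨ i.val + 1 = t ∨ i.val = t)))) := by
  simp only [Gndt, SimpleGraph.fromRel_adj, ne_eq, Fin.ext_iff]
  omega

lemma card_SS (hd : 2 ≤ d) (hdn : d + 2 ≤ n) (ht : 2 ≤ t) (ht' : t ≤ d) :
    (SS n d t).card = n - d := by
  have : SS n d t = insert (⟨t - 1, by omega⟩ : Fin n) (Finset.Ici ⟨d + 1, by omega⟩) := by
    ext i
    simp only [mem_SS, Finset.mem_insert, Finset.mem_Ici, Fin.ext_iff, Fin.le_def]
    omega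
  rw [this, Finset.card_insert_of_notMem, Fin.card_Ici]
  · simp; omega
  · simp [Fin.le_def]; omega

lemma TT_eq (hd : 2 ≤ d) (hdn : d + 2 ≤ n) (ht : 2 ≤ t) (ht' : t ≤ d) :
    TT n d t = insert (⟨t - 2, by omega⟩ : Fin n) (insert (⟨t, by omega⟩ : Fin n) (SS n d t)) := by
  ext i
  simp only [mem_SS, mem_TT, Finset.mem_insert, Fin.ext_iff]
  omega

lemma a_notMem (hd : 2 ≤ d) (hdn : d + 2 ≤ n) (ht : 2 ≤ t) (ht' : t ≤ d) :
    (⟨t - 2, by omega⟩ : Fin n) ∉ insert (⟨t, by omega⟩ : Fin n) (SS n d t) := by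
  simp only [mem_SS, Finset.mem_insert, Fin.ext_iff]; omega

lemma b_notMem (hdn : d + 2 ≤ n) (ht' : t ≤ d) :
    (⟨t, by omega⟩ : Fin n) ∉ SS n d t := by
  simp only [mem_SS]; omega

/-- test space for the lower bound -/
noncomputable def fU (n d t : ℕ) : (SS n d t → ℝ) →ₗ[ℝ] (Fin n → ℝ) where
  toFun y i := if h : i ∈ SS n d t then y ⟨i, h⟩ else
    if i ∈ TT n d t then - (∑ s, y s) / 2 else 0
  map_add' x y := by
    ext i
    simp only [Pi.add_apply, Finset.sum_add_distrib]
    split_ifs <;> ring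
  map_smul' c x := by
    ext i
    simp only [Pi.smul_apply, smul_eq_mul, ← Finset.mul_sum, RingHom.id_apply]
    split_ifs <;> ring

/-- test space for the upper bound -/
noncomputable def fW (n d t : ℕ) : ({i // i ∉ SS n d t} → ℝ) →ₗ[ℝ] (Fin n → ℝ) where
  toFun y i := if h : i ∉ SS n d t then y ⟨i, h⟩ else 0
  map_add' x y := by
    ext i
    simp only [Pi.add_apply]
    split_ifs <;> simp
  map_smul' c x := by
    ext i
    simp only [Pi.smul_apply, smul_eq_mul, RingHom.id_apply]
    split_ifs <;> simp

lemma low_quad (hd : 2 ≤ d) (hdn : d + 2 ≤ n) (ht : 2 ≤ t) (ht' : t ≤ d) (x : Fin n → ℝ)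
    (hab : x ⟨t - 2, by omega⟩ = x ⟨t, by omega⟩) (hT : ∀ i, i ∉ TT n d t → x i = 0)
    (hs : ∑ i ∈ TT n d t, x i = 0) :
    ((n : ℝ) - d + 2) * (x ⬝ᵥ x) ≤ x ⬝ᵥ (lapMat (Gndt n d t) *ᵥ x) := by
  classical
  rw [lap_quad]
  have hc : ((TT n d t).card : ℝ) = (n : ℝ) - d + 2 := by
    rw [TT_eq hd hdn ht ht', Finset.card_insert_of_notMem (a_notMem hd hdn ht ht'),
      Finset.card_insert_of_notMem (b_notMem hdn ht'), card_SS hd hdn ht ht']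
    push_cast [Nat.cast_sub (show d ≤ n by omega)]
    ring
  have h1 := sq_sum_id (TT n d t) x
  rw [hs, hc] at h1
  have h2 : x ⬝ᵥ x = ∑ i ∈ TT n d t, x i ^2 := by
    simp only [dotProduct, ← sq]
    symm
    apply Finset.sum_subset (Finset.subset_univ _)
    intro i _ hi
    rw [hT i hi]; simp
  rw [h2]
  have h3 : ∑ i ∈ TT n d t, ∑ j ∈ TT n d t, (x i - x j)^2 ≤
      ∑ i, ∑ j, if (Gndt n d t).Adj i j then (x i - x j)^2 else 0 := by
    have hnn : ∀ i j, 0 ≤ (if (Gndt n d t).Adj i j then (x i - x j)^2 else 0) := by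
      intro i j; split_ifs <;> positivity
    calc _ ≤ ∑ i ∈ TT n d t, ∑ j ∈ TT n d t, if (Gndt n d t).Adj i j then (x i - x j)^2 else 0 := by
          refine Finset.sum_le_sum fun i hi => Finset.sum_le_sum fun j hj => ?_
          split_ifs with h
          · exact le_rfl
          · have : x i = x j := by
              rw [Gadj ht] at h
              rw [mem_TT] at hi hj
              have h5 : i.val = j.val ∨ (i.val + 2 = t ∧ j.val = t) ∨ (i.val = t ∧ j.val + 2 = t) := by
                omega
              rcases h5 with h5 | h5 | h5
              · rw [Fin.ext h5]
              · have e1 : (⟨t - 2, by omega⟩ : Fin n) = i := Fin.ext (by simp; omega)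
                have e2 : (⟨t, by omega⟩ : Fin n) = j := Fin.ext (by simp; omega)
                rw [e1, e2] at hab
                exact hab
              · have e1 : (⟨t - 2, by omega⟩ : Fin n) = j := Fin.ext (by simp; omega)
                have e2 : (⟨t, by omega⟩ : Fin n) = i := Fin.ext (by simp; omega)
                rw [e1, e2] at hab
                exact hab.symm
            rw [this]; simp
      _ ≤ ∑ i ∈ TT n d t, ∑ j, if (Gndt n d t).Adj i j then (x i - x j)^2 else 0 := by
          refine Finset.sum_le_sum fun i hi => ?_
          exact Finset.sum_le_sum_of_subset_of_nonneg (Finset.subset_univ _) fun j _ _ => hnn i j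
      _ ≤ _ := Finset.sum_le_sum_of_subset_of_nonneg (Finset.subset_univ _)
          fun i _ _ => Finset.sum_nonneg fun j _ => hnn i j
  linarith

open Classical in
/-- weight of an ordered pair -/
noncomputable def ww (n d t : ℕ) (i j : Fin n) : ℝ :=
  if (Gndt n d t).Adj i j then (if i ∈ SS n d t ∨ j ∈ SS n d t then 1 else 2) else 0

lemma ww_symm (i j : Fin n) : ww n d t i j = ww n d t j i := by
  unfold ww
  by_cases h : (Gndt n d t).Adj i j
  · have h' := h.symm
    simp only [h, h', or_comm]
  · have h' : ¬ (Gndt n d t).Adj j i := fun h2 => h h2.symm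
    simp only [h, h', if_false]

lemma sum_ite_le (p : Fin n → Prop) [DecidablePred p] (q : Prop) [Decidable q]
    (hp : ∀ i j, p i → p j → i = j) (hq : ∀ i, p i → q) :
    ∑ j, (if p j then (2:ℝ) else 0) ≤ if q then 2 else 0 := by
  by_cases h : ∃ i, p i
  · obtain ⟨i, hi⟩ := h
    rw [if_pos (hq i hi), Finset.sum_eq_single i]
    · split_ifs <;> norm_num
    · intro j _ hj
      rw [if_neg]; intro h; exact hj (hp _ _ h hi)
    · simp
  · push Not at h
    simp only [h, if_false, Finset.sum_const_zero]
    split_ifs <;> norm_num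

lemma ww_sum (hd : 2 ≤ d) (hdn : d + 2 ≤ n) (ht : 2 ≤ t) (ht' : t ≤ d) (i : Fin n)
    (hi : i ∉ SS n d t) : ∑ j, ww n d t i j ≤
      (if i.val + 2 = t ∨ i.val = t then (n : ℝ) - d else 0) +
      (if 0 < i.val ∧ i.val ≠ t then 2 else 0) + (if i.val < d ∧ i.val + 2 ≠ t then 2 else 0) := by
  have h1 : ∀ j, ww n d t i j ≤ (if j ∈ SS n d t then
        (if i.val + 2 = t ∨ i.val = t then (1:ℝ) else 0) else 0) +
      (if j.val + 1 = i.val ∧ i.val ≠ t then 2 else 0) +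
      (if i.val + 1 = j.val ∧ j.val ≤ d ∧ i.val + 2 ≠ t then 2 else 0) := by
    intro j
    unfold ww
    simp only [Gadj ht, mem_SS] at hi ⊢
    split_ifs <;> first | (exfalso; omega) | norm_num
  refine (Finset.sum_le_sum fun j _ => h1 j).trans ?_
  rw [Finset.sum_add_distrib, Finset.sum_add_distrib]
  refine add_le_add (add_le_add ?_ ?_) ?_
  · rw [← Finset.sum_filter]
    have : Finset.univ.filter (fun j => j ∈ SS n d t) = SS n d t := by ext; simp
    rw [this, Finset.sum_const, card_SS hd hdn ht ht', nsmul_eq_mul,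
      Nat.cast_sub (show d ≤ n by omega)]
    split_ifs <;> simp
  · apply sum_ite_le
    · intro a b ha hb; apply Fin.ext; omega
    · intro a ha; omega
  · apply sum_ite_le
    · intro a b ha hb; apply Fin.ext; omega
    · intro a ha; omega

lemma up_quad (hd : 2 ≤ d) (hdn : d + 2 ≤ n) (ht : 2 ≤ t) (ht' : t ≤ d) (x : Fin n → ℝ)
    (hS : ∀ i ∈ SS n d t, x i = 0)
    (h : ((n : ℝ) - d + 2) * (x ⬝ᵥ x) ≤ x ⬝ᵥ (lapMat (Gndt n d t) *ᵥ x)) : x = 0 := by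
  classical
  have hnd : (n : ℝ) - d ≥ 2 := by
    have : (d : ℝ) + 2 ≤ n := by exact_mod_cast hdn
    linarith
  rw [lap_quad] at h
  set r : Fin n → Fin n → ℝ := fun i j => if (Gndt n d t).Adj i j ∧ i ∉ SS n d t ∧ j ∉ SS n d t then
    (x i + x j)^2 else 0 with hr
  have hrn : ∀ i j, 0 ≤ r i j := by intro i j; simp only [hr]; split_ifs <;> positivity
  have key : ∀ i j, (if (Gndt n d t).Adj i j then (x i - x j)^2 else 0) =
      ww n d t i j * x i ^2 + ww n d t j i * x j ^2 - r i j := by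
    intro i j
    rw [ww_symm j i]
    simp only [hr, ww]
    by_cases ha : (Gndt n d t).Adj i j
    · by_cases h1 : i ∈ SS n d t
      · simp [ha, h1, hS i h1]
      · by_cases h2 : j ∈ SS n d t
        · simp [ha, h2, hS j h2]
        · simp [ha, h1, h2]; ring
    · simp [ha]
  have hsum : (∑ i, ∑ j, if (Gndt n d t).Adj i j then (x i - x j)^2 else 0) =
      2 * ∑ i, (∑ j, ww n d t i j) * x i ^2 - ∑ i, ∑ j, r i j := by
    simp only [key, Finset.sum_sub_distrib, Finset.sum_add_distrib]
    rw [Finset.sum_comm (f := fun i j => ww n d t j i * x j ^2)]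
    simp only [Finset.sum_mul]
    ring
  rw [hsum] at h
  have h2 : x ⬝ᵥ x = ∑ i, x i ^2 := by simp [dotProduct, sq]
  rw [h2] at h
  have hle : ∀ i, 0 ≤ (((n : ℝ) - d + 2) - ∑ j, ww n d t i j) * x i ^2 := by
    intro i
    by_cases hi : i ∈ SS n d t
    · simp [hS i hi]
    · have := ww_sum hd hdn ht ht' i hi
      apply mul_nonneg _ (sq_nonneg _)
      split_ifs at this <;> first | linarith | (exfalso; omega)
  have hR : 0 ≤ ∑ i, ∑ j, r i j := Finset.sum_nonneg fun i _ => Finset.sum_nonneg fun j _ => hrn i j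
  have hD : 0 ≤ ∑ i, (((n : ℝ) - d + 2) - ∑ j, ww n d t i j) * x i ^2 :=
    Finset.sum_nonneg fun i _ => hle i
  have hDe : ∑ i, (((n : ℝ) - d + 2) - ∑ j, ww n d t i j) * x i ^2 =
      ((n : ℝ) - d + 2) * ∑ i, x i ^2 - ∑ i, (∑ j, ww n d t i j) * x i ^2 := by
    simp only [sub_mul _ (∑ j, ww n d t _ j), Finset.sum_sub_distrib, ← Finset.mul_sum]
  have hD0 : ∑ i, (((n : ℝ) - d + 2) - ∑ j, ww n d t i j) * x i ^2 = 0 := by linarith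
  have hR0 : ∑ i, ∑ j, r i j = 0 := by linarith
  have hD1 : ∀ i, (((n : ℝ) - d + 2) - ∑ j, ww n d t i j) * x i ^2 = 0 := fun i =>
    (Finset.sum_eq_zero_iff_of_nonneg (fun i _ => hle i)).1 hD0 i (Finset.mem_univ _)
  have hR1 : ∀ i j, r i j = 0 := by
    intro i j
    have h1 := (Finset.sum_eq_zero_iff_of_nonneg
      (fun i _ => Finset.sum_nonneg fun j _ => hrn i j)).1 hR0 i (Finset.mem_univ _)
    exact (Finset.sum_eq_zero_iff_of_nonneg (fun j _ => hrn i j)).1 h1 j (Finset.mem_univ _)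
  have hend : ∀ i : Fin n, (i.val = 0 ∨ i.val = d) → x i = 0 := by
    intro i hi
    by_cases hiS : i ∈ SS n d t
    · exact hS i hiS
    · have h1 := ww_sum hd hdn ht ht' i hiS
      rcases mul_eq_zero.1 (hD1 i) with h3 | h3
      · exfalso
        split_ifs at h1 <;> first | linarith | omega
      · exact pow_eq_zero_iff two_ne_zero |>.1 h3
  have hstep : ∀ i j : Fin n, (i.val + 1 = j.val ∨ j.val + 1 = i.val) → i.val ≤ d → j.val ≤ d →
      i ∉ SS n d t → x i = 0 → x j = 0 := by
    intro i j hij hi hj hiS hx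
    by_cases hjS : j ∈ SS n d t
    · exact hS j hjS
    · have := hR1 i j
      simp only [hr] at this
      rw [if_pos ⟨by rw [Gadj ht]; omega, hiS, hjS⟩, hx] at this
      simpa using this
  have hleft : ∀ k (hk : k < t), x ⟨k, by omega⟩ = 0 := by
    intro k
    induction k with
    | zero => intro hk; exact hend _ (Or.inl rfl)
    | succ k ih =>
      intro hk
      refine hstep ⟨k, by omega⟩ _ (Or.inl rfl) ?_ ?_ ?_ (ih (by omega))
      · simp; omega
      · simp; omega
      · simp only [mem_SS]; omega
  have hright : ∀ k (hk : k + t ≤ d), x ⟨d - k, by omega⟩ = 0 := by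
    intro k
    induction k with
    | zero => intro hk; exact hend _ (Or.inr rfl)
    | succ k ih =>
      intro hk
      refine hstep ⟨d - k, by omega⟩ _ (Or.inr ?_) ?_ ?_ ?_ (ih (by omega))
      · simp; omega
      · simp
      · simp
      · simp only [mem_SS]; omega
  funext i
  rcases lt_or_ge i.val t with h1 | h1
  · exact hleft i.val h1
  · rcases le_or_gt i.val d with h3 | h3
    · have := hright (d - i.val) (by omega)
      have e : (⟨d - (d - i.val), by omega⟩ : Fin n) = i := Fin.ext (by simp; omega)
      rwa [e] at this
    · exact hS i (by rw [mem_SS]; omega)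

lemma fU_inj (y : SS n d t → ℝ) (h : fU n d t y = 0) : y = 0 := by
  funext s
  have := congrFun h s
  simpa [fU] using this

lemma fU_quad (hd : 2 ≤ d) (hdn : d + 2 ≤ n) (ht : 2 ≤ t) (ht' : t ≤ d) (y : SS n d t → ℝ) :
    ((n : ℝ) - d + 2) * (fU n d t y ⬝ᵥ fU n d t y) ≤
      fU n d t y ⬝ᵥ (lapMat (Gndt n d t) *ᵥ fU n d t y) := by
  have ha : fU n d t y ⟨t - 2, by omega⟩ = - (∑ s, y s) / 2 := by
    have h1 : (⟨t - 2, by omega⟩ : Fin n) ∉ SS n d t := by simp only [mem_SS]; omega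
    have h2 : (⟨t - 2, by omega⟩ : Fin n) ∈ TT n d t := by simp only [mem_TT]; omega
    simp only [fU, LinearMap.coe_mk, AddHom.coe_mk]
    rw [dif_neg h1, if_pos h2]
  have hb : fU n d t y ⟨t, by omega⟩ = - (∑ s, y s) / 2 := by
    have h1 : (⟨t, by omega⟩ : Fin n) ∉ SS n d t := by simp only [mem_SS]; omega
    have h2 : (⟨t, by omega⟩ : Fin n) ∈ TT n d t := by simp [mem_TT]
    simp only [fU, LinearMap.coe_mk, AddHom.coe_mk]
    rw [dif_neg h1, if_pos h2]
  apply low_quad hd hdn ht ht'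
  · rw [ha, hb]
  · intro i hi
    simp only [fU, LinearMap.coe_mk, AddHom.coe_mk]
    rw [dif_neg (by rw [mem_SS]; rw [mem_TT] at hi; omega), if_neg hi]
  · rw [TT_eq hd hdn ht ht', Finset.sum_insert (a_notMem hd hdn ht ht'),
      Finset.sum_insert (b_notMem hdn ht'), ha, hb,
      ← Finset.sum_coe_sort (SS n d t) (fU n d t y)]
    have : ∀ s : SS n d t, fU n d t y s = y s := by intro s; simp [fU]
    simp only [this]
    ring

lemma twin_eig (hd : 2 ≤ d) (hdn : d + 2 ≤ n) (ht : 2 ≤ t) (ht' : t ≤ d) :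
    ∃ x : Fin n → ℝ, x ≠ 0 ∧ lapMat (Gndt n d t) *ᵥ x = ((n : ℝ) - d + 2) • x := by
  classical
  set p : Fin n := ⟨t - 1, by omega⟩ with hp
  set q : Fin n := ⟨d + 1, by omega⟩ with hq
  have hpq : p ≠ q := by simp [hp, hq, Fin.ext_iff]; omega
  refine ⟨Pi.single p 1 - Pi.single q 1, ?_, ?_⟩
  · intro h
    have := congrFun h p
    simp [hpq] at this
  · set x : Fin n → ℝ := Pi.single p 1 - Pi.single q 1 with hx
    have hxp : x p = 1 := by simp [hx, hpq]
    have hxq : x q = -1 := by simp [hx, hpq.symm]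
    have hx0 : ∀ i, i ≠ p → i ≠ q → x i = 0 := by intro i h1 h2; simp [hx, h1, h2]
    have hxs : ∀ T : Finset (Fin n), p ∈ T → q ∈ T → ∑ i ∈ T, x i = 0 := by
      intro T h1 h2
      simp [hx, Finset.sum_sub_distrib, h1, h2]
    have hc : ((TT n d t).card : ℝ) = (n : ℝ) - d + 2 := by
      rw [TT_eq hd hdn ht ht', Finset.card_insert_of_notMem (a_notMem hd hdn ht ht'),
        Finset.card_insert_of_notMem (b_notMem hdn ht'), card_SS hd hdn ht ht']
      push_cast [Nat.cast_sub (show d ≤ n by omega)]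
      ring
    have hpT : p ∈ TT n d t := by simp only [mem_TT, hp]; omega
    have hqT : q ∈ TT n d t := by simp only [mem_TT, hq]; omega
    funext i
    rw [lap_mulVec, Pi.smul_apply, smul_eq_mul]
    by_cases hi : i ∈ SS n d t
    · have : ∀ j, (if (Gndt n d t).Adj i j then x i - x j else 0) =
          if j ∈ TT n d t then x i - x j else 0 := by
        intro j
        by_cases hij : i = j
        · subst hij; simp
        · have hij' : i.val ≠ j.val := fun h => hij (Fin.ext h)
          have : (Gndt n d t).Adj i j ↔ j ∈ TT n d t := by
            rw [Gadj ht, mem_TT]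
            rw [mem_SS] at hi
            omega
          simp only [this]
      simp only [this]
      rw [← Finset.sum_filter]
      have e : Finset.univ.filter (fun j => j ∈ TT n d t) = TT n d t := by ext; simp
      rw [e, Finset.sum_sub_distrib, hxs _ hpT hqT, Finset.sum_const, nsmul_eq_mul, hc, sub_zero]
    · have hip : i ≠ p := by
        rintro rfl; apply hi; simp only [mem_SS, hp]; omega
      have hiq : i ≠ q := by
        rintro rfl; apply hi; simp only [mem_SS, hq]; omega
      rw [hx0 i hip hiq, mul_zero, ← Finset.sum_filter]
      simp only [zero_sub, Finset.sum_neg_distrib]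
      have hadj : (Gndt n d t).Adj i p ↔ (Gndt n d t).Adj i q := by
        simp only [Gadj ht, mem_SS, hp, hq] at hi ⊢
        omega
      rw [neg_eq_zero]
      by_cases h : (Gndt n d t).Adj i p
      · exact hxs _ (by simp [h]) (by simp [hadj.1 h])
      · refine Finset.sum_eq_zero fun j hj => hx0 j ?_ ?_
        · rintro rfl; simp at hj; exact h hj
        · rintro rfl; simp at hj; exact h (hadj.2 hj)

end main

theorem Gndt_eigenvalue_count (n d t : ℕ) (hd : 2 ≤ d) (hdn : d + 2 ≤ n)
    (ht : 2 ≤ t) (ht' : t ≤ d) :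
    mIcc (Gndt n d t) ((n : ℝ) - d + 2) (n : ℝ) = n - d ∧
    lapμ (Gndt n d t) (n - d) = (n : ℝ) - d + 2 := by
  have hM := lap_herm (Gndt n d t)
  set c : ℝ := (n : ℝ) - d + 2 with hcdef
  have hB := lemB hM (fU n d t) c fU_inj (fU_quad hd hdn ht ht')
  have hA := lemA hM (fW n d t) c (by
    intro y hy
    have h0 := up_quad hd hdn ht ht' (fW n d t y) (by intro i hi; simp [fW, hi]) hy
    funext s
    have := congrFun h0 s
    simpa [fW, s.2] using this)
  rw [Fintype.card_coe, card_SS hd hdn ht ht'] at hB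
  rw [Fintype.card_subtype_compl, Fintype.card_coe, card_SS hd hdn ht ht', Fintype.card_fin] at hA
  have hAB := Finset.card_filter_add_card_filter_not (s := Finset.univ)
    (fun i => c ≤ hM.eigenvalues i)
  rw [Finset.card_univ, Fintype.card_fin] at hAB
  have hcount : (Finset.univ.filter (fun i => c ≤ hM.eigenvalues i)).card = n - d := by omega
  have hl : heigList (lapMat (Gndt n d t)) =
      (Finset.univ.val.map hM.eigenvalues).sort (· ≥ ·) := by
    rw [heigList, dif_pos hM]
  set l := heigList (lapMat (Gndt n d t)) with hldef
  have hlc : (l : Multiset ℝ) = Finset.univ.val.map hM.eigenvalues := by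
    rw [hl, Multiset.sort_eq]
  have hmem : ∀ z, z ∈ l ↔ ∃ i, hM.eigenvalues i = z := by
    intro z
    rw [← Multiset.mem_coe, hlc]; simp
  have hlen : (l.filter (fun x => c ≤ x)).length = n - d := by
    rw [← hcount, ← Multiset.coe_card, ← Multiset.filter_coe, hlc, Multiset.filter_map,
      Multiset.card_map]
    rfl
  constructor
  · unfold mIcc
    rw [← hlen]
    congr 1
    apply List.filter_congr
    intro z hz
    obtain ⟨i, rfl⟩ := (hmem z).1 hz
    have := eig_le hM n (by simpa using lap_le (Gndt n d t)) i
    simp [this]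
  · unfold lapμ kthEig
    obtain ⟨x, hx, hxe⟩ := twin_eig hd hdn ht ht'
    apply aux_list
    · rw [← hldef, hl]; exact Multiset.pairwise_sort _ _
    · exact (hmem c).2 (eig_exists hM x c hx hxe)
    · rw [← hldef, hlen]; omega
end

section
/- Let n, d, r, a be integers with 3 ≤ d ≤ n−2, 2 ≤ r ≤ d−1, and 1 ≤ a ≤ n−d−2. Let G_{n,d,r,a} be the graph obtained from the disjoint union of a path P_{d+1} = v₁…v_{d+1} and a complete graph K_{n−d−1} by joining every vertex of K_{n−d−1} to v_r and v_{r+1}, joining a fixed set of a vertices of K_{n−d−1} to v_{r−1}, and joining the remaining n−d−1−a vertices of K_{n−d−1} to v_{r+2}. Then the number of Laplacian eigenvalues of G_{n,d,r,a} in [n−d+2, n] equals n−d. -/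
open Matrix

/-- The graph `G_{n,d,r,a}`: a path `v₁ … v_{d+1}` (vertices `0, …, d`) together with a clique on
vertices `d+1, …, n-1`, all clique vertices joined to `v_r, v_{r+1}` (vertices `r-1, r`), the
first `a` clique vertices (`d+1, …, d+a`) joined to `v_{r-1}` (vertex `r-2`), and the remaining
clique vertices (`d+a+1, …, n-1`) joined to `v_{r+2}` (vertex `r+1`). -/
def Gndra (n d r a : ℕ) : SimpleGraph (Fin n) :=
  SimpleGraph.fromRel (fun i j =>
    (i.val + 1 = j.val ∧ j.val ≤ d) ∨
    (d + 1 ≤ i.val ∧ d + 1 ≤ j.val) ∨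
    (d + 1 ≤ i.val ∧ (j.val = r - 1 ∨ j.val = r)) ∨
    (d + 1 ≤ i.val ∧ i.val ≤ d + a ∧ j.val = r - 2) ∨
    (d + a + 1 ≤ i.val ∧ j.val = r + 1))


theorem eig_span_card {n : ℕ} {M : Matrix (Fin n) (Fin n) ℝ} (h : M.IsHermitian)
    (p : Fin n → Prop) [DecidablePred p] {ι : Type} [Fintype ι] (f : (Fin n → ℝ) →ₗ[ℝ] (ι → ℝ))
    (hf : ∀ x c : Fin n → ℝ, f x = 0 → (∀ i, ¬ p i → c i = 0) →
      x ⬝ᵥ x = ∑ i, c i ^ 2 → x ⬝ᵥ (M *ᵥ x) = ∑ i, h.eigenvalues i * c i ^ 2 → x = 0) :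
    (Finset.univ.filter p).card ≤ Fintype.card ι := by
  classical
  set U : Matrix (Fin n) (Fin n) ℝ := (h.eigenvectorUnitary : Matrix (Fin n) (Fin n) ℝ) with hU
  have hUU : Uᵀ * U = 1 := by
    have := Matrix.UnitaryGroup.star_mul_self h.eigenvectorUnitary
    rwa [Matrix.star_eq_conjTranspose, Matrix.conjTranspose_eq_transpose_of_trivial] at this
  have hMU : M * U = U * diagonal h.eigenvalues := by
    ext i j
    have := congrFun (h.mulVec_eigenvectorBasis j) i
    rw [Matrix.mul_diagonal]
    simp only [Matrix.mulVec, dotProduct, Pi.smul_apply, smul_eq_mul] at this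
    rw [Matrix.mul_apply, mul_comm]
    exact this
  let e : ({i // p i} → ℝ) →ₗ[ℝ] (Fin n → ℝ) :=
    { toFun := fun c i => if hi : p i then c ⟨i, hi⟩ else 0
      map_add' := by intro c c'; ext i; by_cases hi : p i <;> simp [hi]
      map_smul' := by intro c c'; ext i; by_cases hi : p i <;> simp [hi] }
  let g := f ∘ₗ (Matrix.mulVecLin U) ∘ₗ e
  have hg : Function.Injective g := by
    rw [← LinearMap.ker_eq_bot, LinearMap.ker_eq_bot']
    intro c hc
    have key : ∀ y z, (U *ᵥ y) ⬝ᵥ (U *ᵥ z) = y ⬝ᵥ z := by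
      intro y z
      rw [Matrix.dotProduct_mulVec, Matrix.vecMul_mulVec, hUU, Matrix.vecMul_one]
    have h0 := hf (U *ᵥ e c) (e c) hc (by intro i hi; simp [e, hi])
      (by rw [key]; simp [dotProduct, sq])
      (by
        rw [Matrix.mulVec_mulVec, hMU, ← Matrix.mulVec_mulVec, key]
        simp only [dotProduct, Matrix.mulVec_diagonal]
        exact Finset.sum_congr rfl fun i _ => by ring)
    have h1 : e c = 0 := by
      have : Uᵀ *ᵥ (U *ᵥ e c) = 0 := by rw [h0]; simp
      rwa [Matrix.mulVec_mulVec, hUU, Matrix.one_mulVec] at this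
    ext ⟨i, hi⟩
    have := congrFun h1 i
    simpa [e, hi] using this
  have := LinearMap.finrank_le_finrank_of_injective hg
  simpa [Module.finrank_fintype_fun_eq_card, Fintype.card_subtype] using this

theorem mIcc_eq {n : ℕ} (G : SimpleGraph (Fin n)) (h : (lapMat G).IsHermitian) (s t : ℝ) :
    mIcc G s t = (Finset.univ.filter fun i => s ≤ h.eigenvalues i ∧ h.eigenvalues i ≤ t).card := by
  classical
  unfold mIcc heigList
  rw [dif_pos h]
  rw [← List.countP_eq_length_filter, ← Multiset.coe_countP, Multiset.sort_eq, Multiset.countP_map]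
  simp [Finset.card_def]

theorem lap_form {n : ℕ} (G : SimpleGraph (Fin n)) [DecidableRel G.Adj] (x : Fin n → ℝ) :
    x ⬝ᵥ (lapMat G *ᵥ x) = (∑ i, ∑ j, if G.Adj i j then (x i - x j) ^ 2 else 0) / 2 := by
  have := G.lapMatrix_toLinearMap₂' ℝ x
  rw [Matrix.toLinearMap₂'_apply'] at this
  rw [← this]
  unfold lapMat
  congr!

theorem lap_herm_s14 {n : ℕ} (G : SimpleGraph (Fin n)) : (lapMat G).IsHermitian := by
  unfold lapMat
  rw [Matrix.IsHermitian, Matrix.conjTranspose_eq_transpose_of_trivial]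
  let := Classical.decRel G.Adj
  exact G.isSymm_lapMatrix (R := ℝ)

theorem lap_le_s14 {n : ℕ} (G : SimpleGraph (Fin n)) (h : (lapMat G).IsHermitian) (i : Fin n) :
    h.eigenvalues i ≤ n := by
  classical
  set v : Fin n → ℝ := ⇑(h.eigenvectorBasis i) with hv
  have h1 : v ⬝ᵥ v = 1 := by
    have := h.eigenvectorBasis.orthonormal.1 i
    have h2 := EuclideanSpace.real_norm_sq_eq (h.eigenvectorBasis i)
    rw [this] at h2
    simp only [dotProduct, hv]
    rw [← one_pow 2, h2]
    exact Finset.sum_congr rfl fun i _ => by ring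
  have h2 : v ⬝ᵥ (lapMat G *ᵥ v) = h.eigenvalues i := by
    rw [hv, h.mulVec_eigenvectorBasis, dotProduct_smul, ← hv, h1]; simp
  rw [← h2, lap_form]
  have h3 : (∑ i, ∑ j, if G.Adj i j then (v i - v j) ^ 2 else 0) ≤ ∑ i, ∑ j, (v i - v j) ^ 2 := by
    refine Finset.sum_le_sum fun i _ => Finset.sum_le_sum fun j _ => ?_
    split_ifs
    · exact le_rfl
    · positivity
  have h4 : ∑ i, ∑ j, (v i - v j) ^ 2 = 2 * n * (v ⬝ᵥ v) - 2 * (∑ i, v i) ^ 2 := by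
    have : ∀ i j, (v i - v j) ^ 2 = v i ^ 2 + v j ^ 2 - 2 * (v i * v j) := fun i j => by ring
    simp only [this, Finset.sum_add_distrib, Finset.sum_sub_distrib, ← Finset.mul_sum,
      ← Finset.sum_mul, dotProduct]
    simp only [Finset.sum_const, Finset.card_univ, Fintype.card_fin, nsmul_eq_mul,
      ← Finset.mul_sum, ← sq]
    ring
  rw [h1] at h4
  nlinarith [sq_nonneg (∑ i, v i)]

theorem form_split {n : ℕ} (G : SimpleGraph (Fin n)) [DecidableRel G.Adj] (S : Finset (Fin n))
    (t : Fin n → Fin n) (ht : ∀ i ∈ S, t i ∉ S) (h1 : ∀ i ∈ S, ∀ j ∈ S, i ≠ j → G.Adj i j)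
    (h2 : ∀ i ∈ S, ∀ j, j ∉ S → (G.Adj i j ↔ j = t i)) (x : Fin n → ℝ) :
    x ⬝ᵥ (lapMat G *ᵥ x) = (∑ i ∈ S, ∑ j ∈ S, (x i - x j) ^ 2) / 2 + ∑ i ∈ S, (x i - x (t i)) ^ 2
      + (∑ i ∈ Sᶜ, ∑ j ∈ Sᶜ, if G.Adj i j then (x i - x j) ^ 2 else 0) / 2 := by
  rw [lap_form]
  set F : Fin n → Fin n → ℝ := fun i j => if G.Adj i j then (x i - x j) ^ 2 else 0 with hF
  have hs : ∀ i j, F i j = F j i := by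
    intro i j
    simp only [hF, G.adj_comm i j]
    split_ifs <;> ring
  have e0 : ∑ i, ∑ j, F i j = ∑ i ∈ S, ∑ j ∈ S, F i j + ∑ i ∈ S, ∑ j ∈ Sᶜ, F i j
      + (∑ i ∈ Sᶜ, ∑ j ∈ S, F i j + ∑ i ∈ Sᶜ, ∑ j ∈ Sᶜ, F i j) := by
    rw [← Finset.sum_add_distrib, ← Finset.sum_add_distrib]
    simp only [Finset.sum_add_sum_compl]
  have e1 : ∑ i ∈ Sᶜ, ∑ j ∈ S, F i j = ∑ i ∈ S, ∑ j ∈ Sᶜ, F i j := by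
    rw [Finset.sum_comm]
    exact Finset.sum_congr rfl fun i _ => Finset.sum_congr rfl fun j _ => hs j i
  have e2 : ∑ i ∈ S, ∑ j ∈ S, F i j = ∑ i ∈ S, ∑ j ∈ S, (x i - x j) ^ 2 := by
    refine Finset.sum_congr rfl fun i hi => Finset.sum_congr rfl fun j hj => ?_
    by_cases hij : i = j
    · subst hij; simp [hF]
    · simp [hF, h1 i hi j hj hij]
  have e3 : ∑ i ∈ S, ∑ j ∈ Sᶜ, F i j = ∑ i ∈ S, (x i - x (t i)) ^ 2 := by
    refine Finset.sum_congr rfl fun i hi => ?_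
    rw [Finset.sum_eq_single (t i)]
    · simp [hF, (h2 i hi _ (ht i hi)).2 rfl]
    · intro j hj hne
      simp [hF, h2 i hi j (Finset.mem_compl.1 hj), hne]
    · intro h; exact absurd (Finset.mem_compl.2 (ht i hi)) h
  change (∑ i, ∑ j, F i j) / 2 = _ + _ + (∑ i ∈ Sᶜ, ∑ j ∈ Sᶜ, F i j) / 2
  rw [e0, e1, e2, e3]
  ring

theorem form_low {n : ℕ} (G : SimpleGraph (Fin n)) (S : Finset (Fin n))
    (t : Fin n → Fin n) (ht : ∀ i ∈ S, t i ∉ S) (h1 : ∀ i ∈ S, ∀ j ∈ S, i ≠ j → G.Adj i j)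
    (h2 : ∀ i ∈ S, ∀ j, j ∉ S → (G.Adj i j ↔ j = t i)) (x : Fin n → ℝ)
    (hx : ∀ i, i ∉ S → x i = 0) (hs : ∑ i ∈ S, x i = 0) :
    x ⬝ᵥ (lapMat G *ᵥ x) = (S.card + 1) * (x ⬝ᵥ x) := by
  classical
  rw [form_split G S t ht h1 h2]
  have e1 : ∑ i ∈ S, (x i - x (t i)) ^ 2 = ∑ i ∈ S, x i * x i :=
    Finset.sum_congr rfl fun i hi => by rw [hx _ (ht i hi)]; ring
  have e2 : (∑ i ∈ Sᶜ, ∑ j ∈ Sᶜ, if G.Adj i j then (x i - x j) ^ 2 else 0) = 0 := by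
    refine Finset.sum_eq_zero fun i hi => Finset.sum_eq_zero fun j hj => ?_
    rw [hx i (Finset.mem_compl.1 hi), hx j (Finset.mem_compl.1 hj)]; simp
  have e3 : x ⬝ᵥ x = ∑ i ∈ S, x i * x i := by
    rw [dotProduct]
    exact (Finset.sum_subset (Finset.subset_univ S) fun i _ hi => by rw [hx i hi]; ring).symm
  have e4 : ∑ i ∈ S, ∑ j ∈ S, (x i - x j) ^ 2
      = 2 * S.card * (∑ i ∈ S, x i * x i) - 2 * (∑ i ∈ S, x i) ^ 2 := by
    have : ∀ i j, (x i - x j) ^ 2 = x i ^ 2 + x j ^ 2 - 2 * (x i * x j) := fun i j => by ring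
    simp only [this, Finset.sum_add_distrib, Finset.sum_sub_distrib, ← Finset.mul_sum,
      ← Finset.sum_mul]
    simp only [Finset.sum_const, nsmul_eq_mul, ← Finset.mul_sum, ← sq]
    ring
  rw [e1, e2, e3, e4, hs]
  ring

theorem form_up {n : ℕ} (G : SimpleGraph (Fin n)) (S S1 S2 : Finset (Fin n))
    (t : Fin n → Fin n) (ht : ∀ i ∈ S, t i ∉ S) (h1 : ∀ i ∈ S, ∀ j ∈ S, i ≠ j → G.Adj i j)
    (h2 : ∀ i ∈ S, ∀ j, j ∉ S → (G.Adj i j ↔ j = t i)) (y z : Fin n) (hyz : y ≠ z)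
    (hSd : Disjoint S1 S2) (hS : S = S1 ∪ S2) (hy : ∀ i ∈ S1, t i = y) (hz : ∀ i ∈ S2, t i = z)
    (hyS : y ∉ S) (hzS : z ∉ S) (hp : 2 ≤ S1.card) (hq : 2 ≤ S2.card)
    (h3 : ∀ i, i ∉ S → ∃ u v : Fin n, (∀ j, j ∉ S → G.Adj i j → j = u ∨ j = v))
    (h4 : ∃ u, ∀ j, j ∉ S → G.Adj y j → j = u) (h5 : ∃ u, ∀ j, j ∉ S → G.Adj z j → j = u)
    (x : Fin n → ℝ) (c : ℝ) (hx : ∀ i ∈ S, x i = c)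
    (hge : (S.card + 1) * (x ⬝ᵥ x) ≤ x ⬝ᵥ (lapMat G *ᵥ x)) : x = 0 := by
  classical
  rw [form_split G S t ht h1 h2] at hge
  have hcard : (S.card : ℝ) = S1.card + S2.card := by
    rw [hS, Finset.card_union_of_disjoint hSd]; push_cast; ring
  set T := (Sᶜ.erase y).erase z with hT
  have split : ∀ g : Fin n → ℝ, ∑ i ∈ Sᶜ, g i = g y + g z + ∑ i ∈ T, g i := by
    intro g
    rw [← Finset.add_sum_erase Sᶜ g (Finset.mem_compl.2 hyS),
      ← Finset.add_sum_erase (Sᶜ.erase y) g (Finset.mem_erase.2 ⟨hyz.symm, Finset.mem_compl.2 hzS⟩)]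
    ring
  have e1 : ∑ i ∈ S, ∑ j ∈ S, (x i - x j) ^ 2 = 0 :=
    Finset.sum_eq_zero fun i hi => Finset.sum_eq_zero fun j hj => by rw [hx i hi, hx j hj]; ring
  have e2 : ∑ i ∈ S, (x i - x (t i)) ^ 2 =
      S1.card * (c - x y) ^ 2 + S2.card * (c - x z) ^ 2 := by
    have a1 : ∑ i ∈ S1, (x i - x (t i)) ^ 2 = ∑ i ∈ S1, (c - x y) ^ 2 :=
      Finset.sum_congr rfl fun i hi => by
        rw [hy i hi, hx i (by rw [hS]; exact Finset.mem_union_left _ hi)]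
    have a2 : ∑ i ∈ S2, (x i - x (t i)) ^ 2 = ∑ i ∈ S2, (c - x z) ^ 2 :=
      Finset.sum_congr rfl fun i hi => by
        rw [hz i hi, hx i (by rw [hS]; exact Finset.mem_union_right _ hi)]
    have a3 : ∑ i ∈ S, (x i - x (t i)) ^ 2 =
        ∑ i ∈ S1, (x i - x (t i)) ^ 2 + ∑ i ∈ S2, (x i - x (t i)) ^ 2 := by
      conv_lhs => rw [hS]
      exact Finset.sum_union hSd
    rw [a3, a1, a2]
    simp
  have e3 : x ⬝ᵥ x = S.card * c ^ 2 + (x y ^ 2 + x z ^ 2 + ∑ i ∈ T, x i ^ 2) := by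
    rw [← split (fun i => x i ^ 2), dotProduct, ← Finset.sum_add_sum_compl S]
    congr 1
    · rw [Finset.sum_congr rfl fun i hi => by rw [hx i hi]]
      simp [sq]
    · exact Finset.sum_congr rfl fun i _ => by ring
  set D : Fin n → ℝ := fun i => ∑ j ∈ Sᶜ, if G.Adj i j then 1 else 0 with hD
  have e4 : (∑ i ∈ Sᶜ, ∑ j ∈ Sᶜ, if G.Adj i j then (x i - x j) ^ 2 else 0) ≤
      4 * ∑ i ∈ Sᶜ, D i * x i ^ 2 := by
    have b0 : (∑ i ∈ Sᶜ, ∑ j ∈ Sᶜ, if G.Adj i j then (x i - x j) ^ 2 else 0) ≤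
        ∑ i ∈ Sᶜ, ∑ j ∈ Sᶜ, ((if G.Adj i j then 1 else 0) * (2 * x i ^ 2)
          + (if G.Adj i j then 1 else 0) * (2 * x j ^ 2)) := by
      refine Finset.sum_le_sum fun i _ => Finset.sum_le_sum fun j _ => ?_
      split_ifs
      · nlinarith [sq_nonneg (x i + x j)]
      · simp
    have b1 : ∑ i ∈ Sᶜ, ∑ j ∈ Sᶜ, (if G.Adj i j then (1 : ℝ) else 0) * (2 * x j ^ 2) =
        ∑ i ∈ Sᶜ, ∑ j ∈ Sᶜ, (if G.Adj i j then (1 : ℝ) else 0) * (2 * x i ^ 2) := by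
      rw [Finset.sum_comm]
      simp only [G.adj_comm]
    refine b0.trans (le_of_eq ?_)
    simp only [Finset.sum_add_distrib]
    rw [b1]
    simp only [← Finset.sum_mul, hD]
    rw [← two_mul, Finset.mul_sum, Finset.mul_sum]
    exact Finset.sum_congr rfl fun i _ => by ring
  have dbound : ∀ i, ∀ W : Finset (Fin n), (∀ j, j ∉ S → G.Adj i j → j ∈ W) → D i ≤ W.card := by
    intro i W hW
    simp only [hD, Finset.sum_boole]
    exact_mod_cast Finset.card_le_card fun j hj => by
      rw [Finset.mem_filter, Finset.mem_compl] at hj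
      exact hW j hj.1 hj.2
  have dy : D y ≤ 1 := by
    obtain ⟨u, hu⟩ := h4
    simpa using dbound y {u} fun j hj ha => by simpa using hu j hj ha
  have dz : D z ≤ 1 := by
    obtain ⟨u, hu⟩ := h5
    simpa using dbound z {u} fun j hj ha => by simpa using hu j hj ha
  have dT : ∑ i ∈ T, D i * x i ^ 2 ≤ 2 * ∑ i ∈ T, x i ^ 2 := by
    rw [Finset.mul_sum]
    refine Finset.sum_le_sum fun i hi => mul_le_mul_of_nonneg_right ?_ (sq_nonneg _)
    have hiS : i ∉ S := by
      have := Finset.mem_of_mem_erase (Finset.mem_of_mem_erase hi)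
      exact Finset.mem_compl.1 this
    obtain ⟨u, v, huv⟩ := h3 i hiS
    refine (dbound i {u, v} fun j hj ha => by simpa using huv j hj ha).trans ?_
    exact_mod_cast Finset.card_le_two
  rw [split (fun i => D i * x i ^ 2)] at e4
  rw [e1, e2, e3, hcard] at hge
  have hR : 0 ≤ ∑ i ∈ T, x i ^ 2 := Finset.sum_nonneg fun i _ => sq_nonneg _
  set R := ∑ i ∈ T, x i ^ 2 with hRdef
  have hp' : (2 : ℝ) ≤ S1.card := by exact_mod_cast hp
  have hq' : (2 : ℝ) ≤ S2.card := by exact_mod_cast hq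
  generalize (S1.card : ℝ) = p at *
  generalize (S2.card : ℝ) = q at *
  have dy' := mul_le_mul_of_nonneg_right dy (sq_nonneg (x y))
  have dz' := mul_le_mul_of_nonneg_right dz (sq_nonneg (x z))
  have k1 := mul_nonneg (sub_nonneg.2 hq') (sq_nonneg (x y))
  have k2 := mul_nonneg (sub_nonneg.2 hp') (sq_nonneg (x z))
  have k3 := mul_nonneg (by linarith : 0 ≤ p + q - 4) hR
  have main : 2 * (p * q * c ^ 2) + (x y + p * c) ^ 2 + (x z + q * c) ^ 2 + R ≤ 0 := by
    nlinarith
  have hpq : 0 < p * q := by positivity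
  have m1 := sq_nonneg (x y + p * c)
  have m2 := sq_nonneg (x z + q * c)
  have m3 := mul_nonneg hpq.le (sq_nonneg c)
  have hc : c = 0 := by
    have : p * q * c ^ 2 = 0 := by linarith
    rcases mul_eq_zero.1 this with h | h
    · exact absurd h hpq.ne'
    · exact pow_eq_zero_iff (two_ne_zero) |>.1 h
  have hy0 : x y = 0 := by
    have : (x y + p * c) ^ 2 = 0 := by linarith
    rw [hc] at this
    simpa using this
  have hz0 : x z = 0 := by
    have : (x z + q * c) ^ 2 = 0 := by linarith
    rw [hc] at this
    simpa using this
  have hR0 : R = 0 := by linarith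
  rw [hRdef, Finset.sum_eq_zero_iff_of_nonneg fun i _ => sq_nonneg _] at hR0
  ext i
  by_cases hi : i ∈ S
  · rw [hx i hi, hc]; rfl
  by_cases hiy : i = y
  · rw [hiy, hy0]; rfl
  by_cases hiz : i = z
  · rw [hiz, hz0]; rfl
  have := hR0 i (Finset.mem_erase.2 ⟨hiz, Finset.mem_erase.2 ⟨hiy, Finset.mem_compl.2 hi⟩⟩)
  simpa using this

set_option maxHeartbeats 2000000 in
theorem Gndra_eigenvalue_count (n d r a : ℕ) (hd : 3 ≤ d) (hdn : d + 2 ≤ n)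
    (hr : 2 ≤ r) (hr' : r + 1 ≤ d) (ha : 1 ≤ a) (ha' : a + d + 2 ≤ n) :
    mIcc (Gndra n d r a) ((n : ℝ) - d + 2) (n : ℝ) = n - d := by
  classical
  have hH := lap_herm_s14 (Gndra n d r a)
  have hadj : ∀ i j : Fin n, (Gndra n d r a).Adj i j ↔ i.val ≠ j.val ∧
    (((i.val + 1 = j.val ∧ j.val ≤ d) ∨
    (d + 1 ≤ i.val ∧ d + 1 ≤ j.val) ∨
    (d + 1 ≤ i.val ∧ (j.val = r - 1 ∨ j.val = r)) ∨
    (d + 1 ≤ i.val ∧ i.val ≤ d + a ∧ j.val = r - 2) ∨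
    (d + a + 1 ≤ i.val ∧ j.val = r + 1)) ∨ ((j.val + 1 = i.val ∧ i.val ≤ d) ∨
    (d + 1 ≤ j.val ∧ d + 1 ≤ i.val) ∨
    (d + 1 ≤ j.val ∧ (i.val = r - 1 ∨ i.val = r)) ∨
    (d + 1 ≤ j.val ∧ j.val ≤ d + a ∧ i.val = r - 2) ∨
    (d + a + 1 ≤ j.val ∧ i.val = r + 1))) := by
    intro i j
    rw [Gndra, SimpleGraph.fromRel_adj, Ne, Fin.ext_iff]
  generalize Gndra n d r a = G at *
  let y : Fin n := ⟨r - 2, by omega⟩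
  let z : Fin n := ⟨r + 1, by omega⟩
  let S1 : Finset (Fin n) := insert ⟨r - 1, by omega⟩ (Finset.Icc ⟨d + 1, by omega⟩ ⟨d + a, by omega⟩)
  let S2 : Finset (Fin n) := insert ⟨r, by omega⟩ (Finset.Ici ⟨d + a + 1, by omega⟩)
  have mS1 : ∀ i : Fin n, i ∈ S1 ↔ i.val = r - 1 ∨ (d + 1 ≤ i.val ∧ i.val ≤ d + a) := by
    intro i
    simp [S1, Fin.ext_iff, Fin.le_def]
  have mS2 : ∀ i : Fin n, i ∈ S2 ↔ i.val = r ∨ d + a + 1 ≤ i.val := by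
    intro i
    simp [S2, Fin.ext_iff, Fin.le_def]
  have cS1 : S1.card = a + 1 := by
    rw [Finset.card_insert_of_notMem, Fin.card_Icc]
    · simp only; omega
    · simp [Fin.le_def]; omega
  have cS2 : S2.card = n - d - a := by
    rw [Finset.card_insert_of_notMem, Fin.card_Ici]
    · simp only; omega
    · simp [Fin.le_def]; omega
  have hdisj : Disjoint S1 S2 := by
    rw [Finset.disjoint_left]
    intro i h1 h2
    rw [mS1] at h1; rw [mS2] at h2
    omega
  let S := S1 ∪ S2
  have mS : ∀ i : Fin n, i ∈ S ↔ i.val = r - 1 ∨ i.val = r ∨ d + 1 ≤ i.val := by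
    intro i
    simp only [S, Finset.mem_union, mS1, mS2]
    omega
  have cS : S.card = n - d + 1 := by
    rw [Finset.card_union_of_disjoint hdisj, cS1, cS2]; omega
  have cSR : (S.card : ℝ) + 1 = (n : ℝ) - d + 2 := by
    rw [cS]; push_cast [Nat.cast_sub (by omega : d ≤ n)]; ring
  let t : Fin n → Fin n := fun i => if i ∈ S1 then y else z
  have hy : ∀ i ∈ S1, t i = y := fun i hi => by simp [t, hi]
  have hz : ∀ i ∈ S2, t i = z := fun i hi => by
    simp [t, Finset.disjoint_right.1 hdisj hi]
  have hyS : y ∉ S := by rw [mS]; simp only [y]; omega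
  have hzS : z ∉ S := by rw [mS]; simp only [z]; omega
  have ht : ∀ i ∈ S, t i ∉ S := by
    intro i hi
    simp only [t]; split_ifs
    · exact hyS
    · exact hzS
  have h1 : ∀ i ∈ S, ∀ j ∈ S, i ≠ j → G.Adj i j := by
    intro i hi j hj hij
    rw [mS] at hi hj
    rw [Ne, Fin.ext_iff] at hij
    rw [hadj]
    omega
  have h2 : ∀ i ∈ S, ∀ j, j ∉ S → (G.Adj i j ↔ j = t i) := by
    intro i hi j hj
    rw [mS] at hi hj
    rw [hadj, Fin.ext_iff]
    by_cases h : i ∈ S1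
    · have e : (t i).val = r - 2 := by rw [hy i h]
      rw [e]
      rw [mS1] at h
      omega
    · have e : (t i).val = r + 1 := by simp [t, h, z]
      rw [e]
      rw [mS1] at h
      have := i.isLt
      omega
  have h3 : ∀ i, i ∉ S → ∃ u v : Fin n, (∀ j, j ∉ S → G.Adj i j → j = u ∨ j = v) := by
    intro i hi
    rw [mS] at hi
    refine ⟨⟨i.val - 1, by omega⟩, ⟨i.val + 1, by omega⟩, fun j hj h => ?_⟩
    rw [mS] at hj
    rw [hadj] at h
    simp only [Fin.ext_iff]
    omega
  have h4 : ∃ u, ∀ j, j ∉ S → G.Adj y j → j = u := by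
    refine ⟨⟨r - 2 - 1, by omega⟩, fun j hj h => ?_⟩
    rw [mS] at hj
    rw [hadj] at h
    simp only [Fin.ext_iff, y] at h ⊢
    omega
  have h5 : ∃ u, ∀ j, j ∉ S → G.Adj z j → j = u := by
    refine ⟨⟨r + 2, by omega⟩, fun j hj h => ?_⟩
    rw [mS] at hj
    rw [hadj] at h
    simp only [Fin.ext_iff, z] at h ⊢
    omega
  have hyz : y ≠ z := by
    simp only [Ne, Fin.ext_iff, y, z]; omega
  rw [mIcc_eq G hH]
  set c : ℝ := (n : ℝ) - d + 2 with hc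
  have efilter : (Finset.univ.filter fun i => c ≤ hH.eigenvalues i ∧ hH.eigenvalues i ≤ n)
      = Finset.univ.filter fun i => c ≤ hH.eigenvalues i := by
    ext i; simp [lap_le_s14 G hH i]
  rw [efilter]
  -- at least: few eigenvalues below `c`
  have B1 : (Finset.univ.filter fun i => ¬ c ≤ hH.eigenvalues i).card ≤ d := by
    have := eig_span_card hH (fun i => ¬ c ≤ hH.eigenvalues i)
      (ι := Option {i // i ∉ S})
      (LinearMap.pi fun o => match o with
        | none => ∑ i ∈ S, LinearMap.proj (R := ℝ) (φ := fun _ : Fin n => ℝ) i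
        | some j => LinearMap.proj (R := ℝ) (φ := fun _ : Fin n => ℝ) j.1) ?_
    · refine this.trans ?_
      rw [Fintype.card_option, Fintype.card_subtype_compl]
      simp [cS]
      omega
    · intro x w hx hw e1 e2
      have hx0 : ∀ i, i ∉ S → x i = 0 := by
        intro i hi
        have := congrFun hx (some ⟨i, hi⟩)
        simpa using this
      have hxs : ∑ i ∈ S, x i = 0 := by
        have := congrFun hx none
        simpa using this
      have hlow := form_low G S t ht h1 h2 x hx0 hxs
      rw [cSR, e1, e2, Finset.mul_sum] at hlow
      have hle : ∀ i, 0 ≤ (c - hH.eigenvalues i) * w i ^ 2 := by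
        intro i
        by_cases hi : c ≤ hH.eigenvalues i
        · rw [hw i (by simpa using hi)]; simp
        · exact mul_nonneg (by linarith) (sq_nonneg _)
      have hsum : ∑ i, (c - hH.eigenvalues i) * w i ^ 2 = 0 := by
        simp only [sub_mul, Finset.sum_sub_distrib]
        rw [hlow]; ring
      rw [Finset.sum_eq_zero_iff_of_nonneg fun i _ => hle i] at hsum
      have hw0 : ∀ i, w i = 0 := by
        intro i
        by_cases hi : c ≤ hH.eigenvalues i
        · exact hw i (by simpa using hi)
        · rcases mul_eq_zero.1 (hsum i (Finset.mem_univ i)) with h | h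
          · exact absurd (by linarith) hi
          · simpa using h
      simp only [hw0] at e1
      exact dotProduct_self_eq_zero.1 (by rw [e1]; simp)
  have B2 : (Finset.univ.filter fun i => c ≤ hH.eigenvalues i).card ≤ n - d := by
    let r0 : Fin n := ⟨r, by omega⟩
    have hr0 : r0 ∈ S := by rw [mS]; simp [r0]
    have := eig_span_card hH (fun i => c ≤ hH.eigenvalues i)
      (ι := {i // i ∈ S.erase r0})
      (LinearMap.pi fun j => LinearMap.proj (R := ℝ) (φ := fun _ : Fin n => ℝ) j.1
        - LinearMap.proj (R := ℝ) (φ := fun _ : Fin n => ℝ) r0) ?_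
    · refine this.trans ?_
      rw [Fintype.card_coe, Finset.card_erase_of_mem hr0, cS]
      omega
    · intro x w hx hw e1 e2
      refine form_up G S S1 S2 t ht h1 h2 y z hyz hdisj rfl hy hz hyS hzS (by omega) (by omega)
        h3 h4 h5 x (x r0) ?_ ?_
      · intro i hi
        by_cases h : i = r0
        · rw [h]
        · have := congrFun hx ⟨i, Finset.mem_erase.2 ⟨h, hi⟩⟩
          simpa [sub_eq_zero] using this
      · rw [cSR, e1, e2, Finset.mul_sum]
        refine Finset.sum_le_sum fun i _ => ?_
        by_cases hi : c ≤ hH.eigenvalues i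
        · exact mul_le_mul_of_nonneg_right hi (sq_nonneg _)
        · rw [hw i hi]; simp
  have B3 := Finset.card_filter_add_card_filter_not (s := (Finset.univ : Finset (Fin n)))
    (fun i => c ≤ hH.eigenvalues i)
  rw [Finset.card_univ, Fintype.card_fin] at B3
  omega
end

section
/- Let G be a connected graph of order n with diameter d ≥ 2 such that G is not the path P_{d+1}. Then the number of Laplacian eigenvalues of G (with multiplicity) in the interval [n−d+2, n] is at most n−d; equivalently, μ_{n−d+1}(G) < n−d+2. -/
open Matrix

open Finset in
/-- The strict inequality on the path. -/
lemma path_ineq (d j : ℕ) (hj : j ≤ d) (y : ℕ → ℝ) (hyj : y j = 0)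
    (hne : ∃ i ≤ d, y i ≠ 0) :
    ∑ i ∈ range d, (y i - y (i + 1)) ^ 2
      + ∑ i ∈ range (d + 1), (if i ≤ j + 1 ∧ j ≤ i + 1 then y i ^ 2 else 0)
      < 4 * ∑ i ∈ range (d + 1), y i ^ 2 := by
  by_contra! hcon
  have h1 : ∑ i ∈ range d, (y i - y (i + 1)) ^ 2
      = 2 * ∑ i ∈ range d, y i ^ 2 + 2 * ∑ i ∈ range d, y (i + 1) ^ 2
        - ∑ i ∈ range d, (y i + y (i + 1)) ^ 2 := by
    rw [mul_sum, mul_sum, ← sum_add_distrib, ← sum_sub_distrib]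
    exact sum_congr rfl fun i _ => by ring
  have h2 := sum_range_succ (fun i => y i ^ 2) d
  have h3 := sum_range_succ' (fun i => y i ^ 2) d
  have h4 : ∑ i ∈ range (d + 1), (if i ≤ j + 1 ∧ j ≤ i + 1 then y i ^ 2 else 0)
      = ∑ i ∈ range (d + 1), (if i + 1 = j then y i ^ 2 else 0)
        + ∑ i ∈ range (d + 1), (if i = j + 1 then y i ^ 2 else 0) := by
    rw [← sum_add_distrib]
    refine sum_congr rfl fun i _ => ?_
    rcases lt_trichotomy i j with h | h | h
    · by_cases h' : i + 1 = j
      · rw [if_pos (by omega), if_pos h', if_neg (by omega)]; ring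
      · rw [if_neg (by omega), if_neg h', if_neg (by omega)]; ring
    · subst h; simp [hyj]
    · by_cases h' : i = j + 1
      · rw [if_pos (by omega), if_neg (by omega), if_pos h']; ring
      · rw [if_neg (by omega), if_neg (by omega), if_neg h']; ring
  rw [sum_range_succ (fun i => if i + 1 = j then y i ^ 2 else 0),
    sum_range_succ' (fun i => if i = j + 1 then y i ^ 2 else 0),
    if_neg (by omega), if_neg (by omega)] at h4
  have h5 : ∑ i ∈ range d, (y i + y (i + 1)) ^ 2
      = ∑ i ∈ range d, (if i + 1 = j then y i ^ 2 else 0)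
        + ∑ i ∈ range d, (if i + 1 = j + 1 then y (i + 1) ^ 2 else 0)
        + ∑ i ∈ range d, (if i + 1 = j ∨ i = j then 0 else (y i + y (i + 1)) ^ 2) := by
    rw [← sum_add_distrib, ← sum_add_distrib]
    refine sum_congr rfl fun i _ => ?_
    by_cases h' : i + 1 = j
    · rw [if_pos h', if_neg (by omega), if_pos (by omega), h', hyj]; ring
    · by_cases h'' : i = j
      · rw [if_neg h', if_pos (by omega), if_pos (by omega), h'', hyj]; ring
      · rw [if_neg h', if_neg (by omega), if_neg (by omega)]; ring
  have hnn : ∀ i ∈ range d, (0 : ℝ) ≤ (if i + 1 = j ∨ i = j then 0 else (y i + y (i + 1)) ^ 2) := by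
    intro i _; split_ifs <;> positivity
  have hS := sum_nonneg hnn
  have h0 : y 0 = 0 := by
    have : y 0 ^ 2 = 0 := by nlinarith [sq_nonneg (y 0), sq_nonneg (y d)]
    simpa using this
  have hd0 : y d = 0 := by
    have : y d ^ 2 = 0 := by nlinarith [sq_nonneg (y 0), sq_nonneg (y d)]
    simpa using this
  have hS0 : ∑ i ∈ range d, (if i + 1 = j ∨ i = j then 0 else (y i + y (i + 1)) ^ 2) = 0 := by
    nlinarith [sq_nonneg (y 0), sq_nonneg (y d)]
  rw [sum_eq_zero_iff_of_nonneg hnn] at hS0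
  have hrel : ∀ i < d, i + 1 ≠ j → i ≠ j → y i + y (i + 1) = 0 := by
    intro i hi ha hb
    have := hS0 i (mem_range.2 hi)
    rw [if_neg (by tauto)] at this
    simpa using this
  have hleft : ∀ i, i ≤ j → y i = 0 := by
    intro i
    induction i with
    | zero => intro _; exact h0
    | succ k ih =>
      intro hk
      rcases eq_or_ne (k + 1) j with h | h
      · rw [h, hyj]
      · have := hrel k (by omega) h (by omega)
        have := ih (by omega)
        linarith
  have hright : ∀ k, k ≤ d → j ≤ d - k → y (d - k) = 0 := by
    intro k
    induction k with
    | zero => intro _ _; exact hd0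
    | succ k ih =>
      intro hk hjk
      rcases eq_or_ne (d - (k + 1)) j with h | h
      · rw [h, hyj]
      · have h6 := hrel (d - (k + 1)) (by omega) (by omega) h
        have h7 := ih (by omega) (by omega)
        rw [show d - (k + 1) + 1 = d - k by omega] at h6
        linarith
  obtain ⟨i, hi, hyi⟩ := hne
  rcases le_total i j with h | h
  · exact hyi (hleft i h)
  · apply hyi
    have := hright (d - i) (by omega) (by omega)
    rwa [show d - (d - i) = i by omega] at this

open Finset in
lemma quad_bound {V : Type} [Fintype V] [DecidableEq V] (G : SimpleGraph V)
    [DecidableRel G.Adj] (f : V → ℕ) (d : ℕ)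
    (hf : ∀ a b, G.Adj a b → f a ≤ f b + 1) (hfd : ∀ a, f a ≤ d)
    (p : ℕ → V) (hp : ∀ i ≤ d, f (p i) = i) (u : V) (hu : u ∉ (range (d + 1)).image p)
    (x : V → ℝ) (hx : ∀ v, v ∉ (range (d + 1)).image p → x v = 0) (hxu : x (p (f u)) = 0)
    (hne : x ≠ 0) :
    (∑ a, ∑ b, if G.Adj a b then (x a - x b) ^ 2 else 0) / 2
      < ((Fintype.card V : ℝ) - d + 2) * ∑ a, x a ^ 2 := by
  set P := (range (d + 1)).image p with hP
  have hinj : Set.InjOn p (range (d + 1)) := by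
    intro a ha b hb hab
    simp only [coe_range, Set.mem_Iio] at ha hb
    rw [← hp a (by omega), ← hp b (by omega), hab]
  have hcardP : #P = d + 1 := by rw [hP, card_image_of_injOn hinj, card_range]
  have hsumP : ∀ g : V → ℝ, ∑ a ∈ P, g a = ∑ i ∈ range (d + 1), g (p i) := by
    intro g; rw [hP, sum_image hinj]
  have hcardPc : (#Pᶜ : ℝ) = (Fintype.card V : ℝ) - d - 1 := by
    rw [card_compl, hcardP, Nat.cast_sub (hcardP ▸ card_le_univ P)]; push_cast; ring
  set F : V → V → ℝ := fun a b => if G.Adj a b then (x a - x b) ^ 2 else 0 with hF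
  have hFs : ∀ a b, F a b = F b a := by
    intro a b
    simp only [hF, G.adj_comm a b]
    split_ifs <;> ring
  have hnorm : ∑ a, x a ^ 2 = ∑ i ∈ range (d + 1), x (p i) ^ 2 := by
    rw [← hsumP (fun a => x a ^ 2)]
    refine (sum_subset (subset_univ P) fun a _ ha => ?_).symm
    simp [hx a ha]
  have hsplit : ∑ a, ∑ b, F a b = ∑ a ∈ P, ∑ b ∈ P, F a b + 2 * ∑ a ∈ Pᶜ, ∑ b ∈ P, F a b := by
    have e : ∀ a, ∑ b, F a b = ∑ b ∈ P, F a b + ∑ b ∈ Pᶜ, F a b := fun a =>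
      (sum_add_sum_compl P _).symm
    rw [← sum_add_sum_compl P]
    simp_rw [e]
    rw [sum_add_distrib, sum_add_distrib]
    have z : ∑ a ∈ Pᶜ, ∑ b ∈ Pᶜ, F a b = 0 := by
      refine sum_eq_zero fun a ha => sum_eq_zero fun b hb => ?_
      simp only [hF, hx a (mem_compl.1 ha), hx b (mem_compl.1 hb)]
      simp
    have s : ∑ a ∈ P, ∑ b ∈ Pᶜ, F a b = ∑ a ∈ Pᶜ, ∑ b ∈ P, F a b := by
      rw [sum_comm]
      exact sum_congr rfl fun a _ => sum_congr rfl fun b _ => hFs _ _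
    rw [z, s]; ring
  have hPP : ∑ a ∈ P, ∑ b ∈ P, F a b ≤ 2 * ∑ i ∈ range d, (x (p i) - x (p (i + 1))) ^ 2 := by
    rw [hsumP]
    simp_rw [hsumP]
    have step : ∑ i ∈ range (d + 1), ∑ k ∈ range (d + 1), F (p i) (p k)
        ≤ ∑ i ∈ range (d + 1), ∑ k ∈ range (d + 1), (if k = i + 1 then (x (p i) - x (p k)) ^ 2 else 0)
          + ∑ i ∈ range (d + 1), ∑ k ∈ range (d + 1),
            (if i = k + 1 then (x (p i) - x (p k)) ^ 2 else 0) := by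
      rw [← sum_add_distrib]
      refine sum_le_sum fun i hi => ?_
      rw [← sum_add_distrib]
      refine sum_le_sum fun k hk => ?_
      rw [mem_range] at hi hk
      simp only [hF]
      by_cases hadj : G.Adj (p i) (p k)
      · have a1 := hf _ _ hadj
        have a2 := hf _ _ hadj.symm
        rw [hp i (by omega), hp k (by omega)] at a1 a2
        have a3 : i ≠ k := by rintro rfl; exact G.loopless.irrefl _ hadj
        rw [if_pos hadj]
        rcases lt_or_gt_of_ne a3 with h | h
        · rw [if_pos (by omega), if_neg (by omega)]; simp
        · rw [if_neg (by omega), if_pos (by omega)]; simp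
      · rw [if_neg hadj]
        split_ifs <;> positivity
    have e1 : ∑ i ∈ range (d + 1), ∑ k ∈ range (d + 1),
        (if k = i + 1 then (x (p i) - x (p k)) ^ 2 else 0)
        = ∑ i ∈ range d, (x (p i) - x (p (i + 1))) ^ 2 := by
      rw [sum_range_succ]
      simp_rw [sum_ite_eq' (range (d + 1))]
      rw [if_neg (by simp), add_zero]
      refine sum_congr rfl fun i hi => ?_
      rw [mem_range] at hi
      rw [if_pos (by simpa using hi)]
    have e2 : ∑ i ∈ range (d + 1), ∑ k ∈ range (d + 1),
        (if i = k + 1 then (x (p i) - x (p k)) ^ 2 else 0)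
        = ∑ i ∈ range d, (x (p i) - x (p (i + 1))) ^ 2 := by
      rw [sum_comm, ← e1]
      refine sum_congr rfl fun i _ => sum_congr rfl fun k _ => ?_
      split_ifs <;> ring
    rw [e1, e2] at step
    linarith
  have hout : ∀ a ∈ Pᶜ, ∑ b ∈ P, F a b ≤ ∑ i ∈ range (d + 1), x (p i) ^ 2 := by
    intro a ha
    rw [hsumP]
    refine sum_le_sum fun i _ => ?_
    simp only [hF, hx a (mem_compl.1 ha)]
    split_ifs
    · simp
    · positivity
  have houtu : ∑ b ∈ P, F u b
      ≤ ∑ i ∈ range (d + 1), (if i ≤ f u + 1 ∧ f u ≤ i + 1 then x (p i) ^ 2 else 0) := by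
    rw [hsumP]
    refine sum_le_sum fun i hi => ?_
    rw [mem_range] at hi
    simp only [hF, hx u hu]
    by_cases hadj : G.Adj u (p i)
    · have a1 := hf _ _ hadj
      have a2 := hf _ _ hadj.symm
      rw [hp i (by omega)] at a1 a2
      rw [if_pos hadj, if_pos ⟨a2, a1⟩]; simp
    · rw [if_neg hadj]
      split_ifs <;> positivity
  have hPc : ∑ a ∈ Pᶜ, ∑ b ∈ P, F a b
      ≤ ∑ i ∈ range (d + 1), (if i ≤ f u + 1 ∧ f u ≤ i + 1 then x (p i) ^ 2 else 0)
        + ((Fintype.card V : ℝ) - d - 2) * ∑ i ∈ range (d + 1), x (p i) ^ 2 := by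
    have hu' : u ∈ Pᶜ := mem_compl.2 hu
    rw [← add_sum_erase _ _ hu']
    refine add_le_add houtu ?_
    refine (sum_le_card_nsmul _ _ _ fun a ha => hout a (mem_of_mem_erase ha)).trans ?_
    rw [card_erase_of_mem hu', nsmul_eq_mul,
      Nat.cast_sub (Nat.succ_le_of_lt (card_pos.2 ⟨u, hu'⟩)), hcardPc]
    apply le_of_eq; push_cast; ring
  have hne' : ∃ i ≤ d, x (p i) ≠ 0 := by
    obtain ⟨v, hv⟩ := Function.ne_iff.1 hne
    have hvP : v ∈ P := by
      by_contra h; exact hv (hx v h)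
    obtain ⟨i, hi, rfl⟩ := mem_image.1 hvP
    exact ⟨i, by simpa [Nat.lt_succ_iff] using hi, hv⟩
  have key := path_ineq d (f u) (hfd u) (fun i => x (p i)) hxu hne'
  change (∑ a, ∑ b, F a b) / 2 < _
  rw [hsplit, hnorm]
  linarith

/-- Eigenvalue counting: a `d`-dimensional coordinate subspace with small quadratic form. -/
lemma card_eig_lt {V : Type} [Fintype V] [DecidableEq V] (A : Matrix V V ℝ)
    (hA : A.IsHermitian) (c : ℝ) (S : Finset V)
    (h : ∀ x : V → ℝ, (∀ v ∉ S, x v = 0) → x ≠ 0 → x ⬝ᵥ (A *ᵥ x) < c * ∑ a, x a ^ 2) :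
    S.card ≤ (Finset.univ.filter fun i => hA.eigenvalues i < c).card := by
  by_contra! hlt
  let b : V → V → ℝ := fun i => ⇑(hA.eigenvectorBasis i)
  let ext : (S → ℝ) →ₗ[ℝ] (V → ℝ) :=
    { toFun := fun y v => if hv : v ∈ S then y ⟨v, hv⟩ else 0
      map_add' := by intro y z; funext v; simp only [Pi.add_apply]; split_ifs <;> simp
      map_smul' := by
        intro r y; funext v
        simp only [Pi.smul_apply, RingHom.id_apply]; split_ifs <;> simp }
  let T : (S → ℝ) →ₗ[ℝ] ({i // hA.eigenvalues i < c} → ℝ) :=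
    { toFun := fun y i => b i ⬝ᵥ ext y
      map_add' := by intro y z; funext i; simp [dotProduct_add]
      map_smul' := by intro r y; funext i; simp [dotProduct_smul] }
  have hker : LinearMap.ker T ≠ ⊥ := by
    apply LinearMap.ker_ne_bot_of_finrank_lt
    simpa [Fintype.card_subtype] using hlt
  obtain ⟨y, hy, hy0⟩ := (Submodule.ne_bot_iff _).1 hker
  set x := ext y with hx
  have hxS : ∀ v ∉ S, x v = 0 := by
    intro v hv; simp [hx, ext, hv]
  have hx0 : x ≠ 0 := by
    intro h0
    apply hy0
    funext v
    have := congrFun h0 v.1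
    simpa [hx, ext] using this
  have hT : ∀ i, hA.eigenvalues i < c → b i ⬝ᵥ x = 0 := by
    intro i hi
    exact congrFun (LinearMap.mem_ker.1 hy) ⟨i, hi⟩
  have hAb : ∀ i, b i ⬝ᵥ (A *ᵥ x) = hA.eigenvalues i * (b i ⬝ᵥ x) := by
    intro i
    have hs : Aᵀ = A := by simpa [Matrix.IsHermitian] using hA
    rw [dotProduct_mulVec, ← mulVec_transpose, hs]
    show (A *ᵥ ⇑(hA.eigenvectorBasis i)) ⬝ᵥ x = _
    rw [hA.mulVec_eigenvectorBasis, smul_dotProduct]; rfl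
  have par : ∀ z : V → ℝ, x ⬝ᵥ z = ∑ i, (b i ⬝ᵥ x) * (b i ⬝ᵥ z) := by
    intro z
    have := hA.eigenvectorBasis.sum_inner_mul_inner (WithLp.toLp 2 x) (WithLp.toLp 2 z)
    simp only [EuclideanSpace.inner_eq_star_dotProduct, star_trivial] at this
    rw [dotProduct_comm x z, ← this]
    refine Finset.sum_congr rfl fun i _ => ?_
    rw [dotProduct_comm z]
  have h1 := h x hxS hx0
  have h2 : ∑ a, x a ^ 2 = x ⬝ᵥ x := by simp [dotProduct, sq]
  rw [h2, par, par, Finset.mul_sum] at h1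
  refine absurd h1 (not_lt.2 (Finset.sum_le_sum fun i _ => ?_))
  rw [hAb]
  by_cases hi : hA.eigenvalues i < c
  · simp [hT i hi]
  · nlinarith [mul_self_nonneg (b i ⬝ᵥ x), not_lt.1 hi]

/-- In a nonincreasing list, few entries `≥ c` means a late entry is `< c`. -/
lemma sorted_getD_lt (l : List ℝ) (hl : l.Pairwise (· ≥ ·)) (c : ℝ) (k : ℕ) (hk : k < l.length)
    (hc : l.countP (fun x => decide (c ≤ x)) ≤ k) : l.getD k 0 < c := by
  rw [List.getD_eq_getElem _ _ hk]
  by_contra! hcon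
  have h1 : (l.take (k + 1)).countP (fun x => decide (c ≤ x)) = (l.take (k + 1)).length := by
    rw [List.countP_eq_length]
    intro a ha
    obtain ⟨i, hi, rfl⟩ := List.getElem_of_mem ha
    rw [List.getElem_take]
    simp only [decide_eq_true_eq]
    rw [List.length_take] at hi
    rcases eq_or_lt_of_le (show i ≤ k by omega) with h | h
    · subst h; exact hcon
    · exact hcon.trans (List.pairwise_iff_getElem.1 hl i k (by omega) hk h)
  have h2 := (List.take_sublist (k + 1) l).countP_le (p := fun x => decide (c ≤ x))
  rw [h1, List.length_take] at h2
  omega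

lemma path_of_diam {V : Type} [Fintype V] [DecidableEq V]
    (G : SimpleGraph V) (hG : G.Connected) (d : ℕ) (hd : G.diam = d) (hd2 : 2 ≤ d) :
    ∃ (f : V → ℕ) (p : ℕ → V), (∀ a b, G.Adj a b → f a ≤ f b + 1) ∧ (∀ a, f a ≤ d) ∧
      (∀ i ≤ d, f (p i) = i) ∧ (∀ i < d, G.Adj (p i) (p (i + 1))) := by
  have := hG.nonempty
  obtain ⟨s, t, hst⟩ := G.exists_dist_eq_diam
  obtain ⟨w, hw⟩ := hG.exists_walk_length_eq_dist s t
  rw [hst, hd] at hw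
  have hf : ∀ a b, G.Adj a b → G.dist s a ≤ G.dist s b + 1 := by
    intro a b hab
    have := hG.dist_triangle (u := s) (v := b) (w := a)
    rwa [SimpleGraph.dist_eq_one_iff_adj.2 hab.symm] at this
  have hadj : ∀ i < d, G.Adj (w.getVert i) (w.getVert (i + 1)) := fun i hi =>
    w.adj_getVert_succ (by omega)
  refine ⟨fun v => G.dist s v, w.getVert, hf, ?_, ?_, hadj⟩
  · intro a
    rw [← hd]
    exact SimpleGraph.dist_le_diam (SimpleGraph.ediam_ne_top_of_diam_ne_zero (by omega))
  · have up : ∀ i ≤ d, G.dist s (w.getVert i) ≤ i := by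
      intro i
      induction i with
      | zero => intro _; simp
      | succ k ih =>
        intro hk
        exact (hf _ _ (hadj k (by omega)).symm).trans (by have := ih (by omega); omega)
    have down : ∀ k ≤ d, d - k ≤ G.dist s (w.getVert (d - k)) := by
      intro k
      induction k with
      | zero =>
        intro _
        have : w.getVert d = t := by rw [← hw]; exact w.getVert_length
        simp [this, hst, hd]
      | succ k ih =>
        intro hk
        have h1 := ih (by omega)
        have h2 := hadj (d - (k + 1)) (by omega)
        rw [show d - (k + 1) + 1 = d - k by omega] at h2
        have h3 := hf _ _ h2.symm
        omega
    intro i hi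
    have h1 := up i hi
    have h2 := down (d - i) (by omega)
    rw [show d - (d - i) = i by omega] at h2
    show G.dist s (w.getVert i) = i
    omega

theorem conjecture_distribution_lap_eigenvalues {V : Type} [Fintype V] [DecidableEq V]
    (G : SimpleGraph V) (hG : G.Connected) (d : ℕ) (hd : G.diam = d) (hd2 : 2 ≤ d)
    (hP : ¬ Nonempty (G ≃g SimpleGraph.pathGraph (d + 1))) :
    mIcc G ((Fintype.card V : ℝ) - d + 2) (Fintype.card V : ℝ) ≤ Fintype.card V - d ∧
    lapμ G (Fintype.card V - d + 1) < (Fintype.card V : ℝ) - d + 2 := by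
  classical
  obtain ⟨f, p, hf, hfd, hp, hadj⟩ := path_of_diam G hG d hd hd2
  have hinj : Set.InjOn p (Finset.range (d + 1)) := by
    intro a ha b hb hab
    simp only [Finset.coe_range, Set.mem_Iio] at ha hb
    rw [← hp a (by omega), ← hp b (by omega), hab]
  have hcardP : ((Finset.range (d + 1)).image p).card = d + 1 := by
    rw [Finset.card_image_of_injOn hinj, Finset.card_range]
  have hn : d + 1 ≤ Fintype.card V := hcardP ▸ Finset.card_le_univ _
  -- a vertex off the path
  obtain ⟨u, hu⟩ : ∃ u, u ∉ (Finset.range (d + 1)).image p := by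
    by_contra! hall
    apply hP
    have hq : Function.Bijective (fun i : Fin (d + 1) => p i) := by
      constructor
      · intro a b hab
        exact Fin.ext (hinj (by have := a.2; simp; omega) (by have := b.2; simp; omega) hab)
      · intro v
        obtain ⟨i, hi, rfl⟩ := Finset.mem_image.1 (hall v)
        exact ⟨⟨i, Finset.mem_range.1 hi⟩, rfl⟩
    refine ⟨RelIso.symm ⟨Equiv.ofBijective _ hq, ?_⟩⟩
    intro a b
    rw [SimpleGraph.pathGraph_adj]
    show G.Adj (p a) (p b) ↔ _
    have ha := a.2
    have hb := b.2
    constructor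
    · intro h
      have a1 := hf _ _ h
      have a2 := hf _ _ h.symm
      rw [hp a (by omega), hp b (by omega)] at a1 a2
      have a3 : (a : ℕ) ≠ b := by
        intro h'; rw [h'] at h; exact G.loopless.irrefl _ h
      omega
    · rintro (h | h)
      · rw [← h]; exact hadj a (by omega)
      · rw [← h]; exact (hadj b (by omega)).symm
  have hA : (lapMat G).IsHermitian := by
    unfold lapMat
    exact SimpleGraph.isHermitian_lapMatrix _ _
  set c : ℝ := (Fintype.card V : ℝ) - d + 2 with hc
  have hcount := card_eig_lt (lapMat G) hA c (((Finset.range (d + 1)).image p).erase (p (f u))) (by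
    intro x hx hne
    have hb := quad_bound G f d hf hfd p hp u hu x
      (fun v hv => hx v fun h => hv (Finset.mem_of_mem_erase h))
      (hx _ (by simp)) hne
    have e := SimpleGraph.lapMatrix_toLinearMap₂' (R := ℝ) G x
    rw [Matrix.toLinearMap₂'_apply'] at e
    have e' : lapMat G = G.lapMatrix ℝ := by
      unfold lapMat; congr!
    rw [e', e]
    exact hb)
  rw [Finset.card_erase_of_mem (Finset.mem_image_of_mem _
    (Finset.mem_range.2 (by have := hfd u; omega))), hcardP] at hcount
  have hcompl : (Finset.univ.filter fun i => c ≤ hA.eigenvalues i).card ≤ Fintype.card V - d := by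
    have := Finset.card_filter_add_card_filter_not (s := (Finset.univ : Finset V))
      (fun i => hA.eigenvalues i < c)
    simp only [not_lt, Finset.card_univ] at this
    omega
  have hlist : heigList (lapMat G) = (Finset.univ.val.map hA.eigenvalues).sort (· ≥ ·) := by
    unfold heigList; rw [dif_pos hA]
  have hlen : (heigList (lapMat G)).length = Fintype.card V := by
    rw [hlist]; simp
  have hsorted : (heigList (lapMat G)).Pairwise (· ≥ ·) := by
    rw [hlist]; exact Multiset.pairwise_sort _ _
  have hcP : (heigList (lapMat G)).countP (fun x => decide (c ≤ x)) ≤ Fintype.card V - d := by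
    refine le_trans (le_of_eq ?_) hcompl
    rw [hlist, ← Multiset.coe_countP, Multiset.sort_eq, Multiset.countP_map]
    rfl
  constructor
  · unfold mIcc
    rw [← List.countP_eq_length_filter]
    refine le_trans (List.countP_mono_left ?_) hcP
    intro a _ ha
    simp only [decide_eq_true_eq] at ha ⊢
    exact ha.1
  · unfold lapμ kthEig
    rw [Nat.add_sub_cancel]
    exact sorted_getD_lt _ hsorted c _ (by omega) hcP
end

section
/- Let n, d, t, a, b be integers with 3 ≤ t ≤ d−2, d ≤ n−3, a, b ≥ 1 and a + b = n−d−1. Let H_{n,d,t;a,b} be the graph obtained from the disjoint union P_{d+1} ∪ K_a ∪ K_b (with P_{d+1} = v₁…v_{d+1}) by joining every vertex of K_a to v_{t−2}, v_{t−1}, v_t and every vertex of K_b to v_t, v_{t+1}, v_{t+2}. Then μ_{n−d}(H_{n,d,t;a,b}) < n−d+2. -/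
open Matrix

/-- The graph `H_{n,d,t;a,b}`: a path `v₁ … v_{d+1}` (vertices `0, …, d`), a clique `K_a`
(vertices `d+1, …, d+a`) each of whose vertices is joined to `v_{t-2}, v_{t-1}, v_t`
(vertices `t-3, t-2, t-1`), and a clique `K_b` (vertices `d+a+1, …, n-1`) each of whose vertices
is joined to `v_t, v_{t+1}, v_{t+2}` (vertices `t-1, t, t+1`). -/
def Hab (n d t a : ℕ) : SimpleGraph (Fin n) :=
  SimpleGraph.fromRel (fun i j =>
    (i.val + 1 = j.val ∧ j.val ≤ d) ∨
    (d + 1 ≤ i.val ∧ i.val ≤ d + a ∧ d + 1 ≤ j.val ∧ j.val ≤ d + a) ∨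
    (d + a + 1 ≤ i.val ∧ d + a + 1 ≤ j.val) ∨
    (d + 1 ≤ i.val ∧ i.val ≤ d + a ∧ (j.val = t - 3 ∨ j.val = t - 2 ∨ j.val = t - 1)) ∨
    (d + a + 1 ≤ i.val ∧ (j.val = t - 1 ∨ j.val = t ∨ j.val = t + 1)))

theorem two_big_aux {ι : Type} [Fintype ι] (f : ι → ℝ) (k : ℕ) (hk : 1 ≤ k) (c : ℝ) (hc : 0 < c)
    (h : c ≤ ((Finset.univ.val.map f).sort (· ≥ ·)).getD k 0) :
    ∃ i j : ι, i ≠ j ∧ c ≤ f i ∧ c ≤ f j := by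
  classical
  set l := (Finset.univ.val.map f).sort (· ≥ ·) with hl
  have hlen : k < l.length := by
    by_contra hcon
    rw [List.getD_eq_default _ _ (by omega)] at h
    linarith
  rw [List.getD_eq_getElem _ _ hlen] at h
  have hs : l.Pairwise (· ≥ ·) := Multiset.pairwise_sort _ _
  have h0 : c ≤ l[0] := by
    have := List.pairwise_iff_getElem.mp hs 0 k (by omega) hlen (by omega)
    exact le_trans h this
  have hcount : 2 ≤ (l.filter (fun x => c ≤ x)).length := by
    have hsub : List.Sublist [l[0], l[k]] l := by
      have h1 : l = l[0] :: l.drop 1 := by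
        rw [← List.drop_eq_getElem_cons (by omega)]; simp
      have h2 : l[k] ∈ l.drop 1 := by
        rw [List.mem_iff_getElem]
        exact ⟨k - 1, by simp; omega, by simp [Nat.sub_add_cancel hk]⟩
      have h3 := (List.singleton_sublist.mpr h2).cons_cons l[0]
      exact h3.trans (by rw [← h1])
    have := (hsub.filter (fun x => decide (c ≤ x))).length_le
    simpa [h0, h] using this
  have hc2 : 2 ≤ (Finset.univ.filter (fun i => c ≤ f i)).card := by
    have e : ((l : Multiset ℝ)) = Finset.univ.val.map f := Multiset.sort_eq _ _
    have e2 := congrArg (fun m => (Multiset.filter (fun x => c ≤ x) m).card) e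
    simp only [Multiset.filter_coe, Multiset.coe_card, Multiset.filter_map, Multiset.card_map] at e2
    rw [e2] at hcount
    simpa [Finset.card, Finset.filter] using hcount
  obtain ⟨i, hi, j, hj, hij⟩ := Finset.one_lt_card.mp (Nat.lt_of_succ_le hc2)
  simp at hi hj
  exact ⟨i, j, hij, hi, hj⟩

theorem form_contra_aux {m : Type} [Fintype m] [DecidableEq m] (M : Matrix m m ℝ)
    (hM : M.IsHermitian) (c : ℝ) (v : m)
    (hform : ∀ x : m → ℝ, x v = 0 → x ≠ 0 → x ⬝ᵥ (M *ᵥ x) < c * (x ⬝ᵥ x))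
    (i j : m) (hij : i ≠ j) (hi : c ≤ hM.eigenvalues i) (hj : c ≤ hM.eigenvalues j) : False := by
  set p : m → ℝ := (hM.eigenvectorBasis i).ofLp with hp
  set q : m → ℝ := (hM.eigenvectorBasis j).ofLp with hq
  have ip : M *ᵥ p = hM.eigenvalues i • p := hM.mulVec_eigenvectorBasis i
  have iq : M *ᵥ q = hM.eigenvalues j • q := hM.mulVec_eigenvectorBasis j
  have on := hM.eigenvectorBasis.orthonormal
  rw [orthonormal_iff_ite] at on
  have pp : p ⬝ᵥ p = 1 := by
    have := on i i
    rw [EuclideanSpace.inner_eq_star_dotProduct, if_pos rfl, star_trivial] at this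
    exact this
  have qq : q ⬝ᵥ q = 1 := by
    have := on j j
    rw [EuclideanSpace.inner_eq_star_dotProduct, if_pos rfl, star_trivial] at this
    exact this
  have pq : p ⬝ᵥ q = 0 := by
    have := on j i
    rw [EuclideanSpace.inner_eq_star_dotProduct, if_neg hij.symm, star_trivial] at this
    exact this
  have qp : q ⬝ᵥ p = 0 := by rw [dotProduct_comm]; exact pq
  obtain ⟨α, β, hv, hne⟩ : ∃ α β : ℝ, α * p v + β * q v = 0 ∧ 0 < α ^ 2 + β ^ 2 := by
    by_cases h : p v = 0
    · exact ⟨1, 0, by simp [h], by norm_num⟩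
    · exact ⟨q v, - p v, by ring, by
        have : 0 < (p v) ^ 2 := by positivity
        nlinarith [sq_nonneg (q v)]⟩
  have e1 : (α • p + β • q) ⬝ᵥ (α • p + β • q) = α ^ 2 + β ^ 2 := by
    simp only [add_dotProduct, dotProduct_add, smul_dotProduct, dotProduct_smul, pp, qq, pq, qp,
      smul_eq_mul]
    ring
  have e2 : (α • p + β • q) ⬝ᵥ (M *ᵥ (α • p + β • q))
      = α ^ 2 * hM.eigenvalues i + β ^ 2 * hM.eigenvalues j := by
    simp only [mulVec_add, mulVec_smul, ip, iq, add_dotProduct, dotProduct_add, smul_dotProduct,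
      dotProduct_smul, pp, qq, pq, qp, smul_eq_mul]
    ring
  have := hform (α • p + β • q) (by simpa using hv) (by
    intro h0
    rw [h0] at e1
    simp at e1
    linarith)
  rw [e1, e2] at this
  nlinarith [mul_le_mul_of_nonneg_left hi (sq_nonneg α), mul_le_mul_of_nonneg_left hj (sq_nonneg β)]

theorem clique_sum_aux {m : Type} [Fintype m] [DecidableEq m] (A : Finset m) (x : m → ℝ) (k : ℝ)
    (hk : (A.card : ℝ) ≤ k) :
    ∑ i, ∑ j, (if i ∈ A ∧ j ∈ A then (x i - x j) ^ 2 else 0)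
      ≤ 2 * ∑ i, (if i ∈ A then k else 0) * x i ^ 2 := by
  have e : ∑ i, ∑ j, (if i ∈ A ∧ j ∈ A then (x i - x j) ^ 2 else 0)
      = ∑ i ∈ A, ∑ j ∈ A, (x i - x j) ^ 2 := by
    simp only [ite_and, Finset.sum_ite_mem, ← Finset.sum_filter]
    rw [← Finset.sum_subset (Finset.subset_univ A)]
    · apply Finset.sum_congr rfl
      intro i hi
      simp [hi]
    · intro i _ hi
      simp [hi]
  have e2 : ∑ i ∈ A, ∑ j ∈ A, (x i - x j) ^ 2
      = 2 * (A.card * ∑ i ∈ A, x i ^ 2) - 2 * (∑ i ∈ A, x i) ^ 2 := by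
    have : ∀ i j, (x i - x j) ^ 2 = x i ^ 2 + x j ^ 2 - 2 * (x i * x j) := by intros; ring
    simp only [this, Finset.sum_sub_distrib, Finset.sum_add_distrib, Finset.sum_const,
      nsmul_eq_mul, ← Finset.mul_sum, ← Finset.sum_mul]
    ring
  have e3 : ∑ i, (if i ∈ A then k else 0) * x i ^ 2 = k * ∑ i ∈ A, x i ^ 2 := by
    simp [ite_mul, Finset.mul_sum]
  rw [e, e2, e3]
  have : 0 ≤ ∑ i ∈ A, x i ^ 2 := Finset.sum_nonneg fun i _ => sq_nonneg _
  nlinarith [mul_le_mul_of_nonneg_right hk this, sq_nonneg (∑ i ∈ A, x i)]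

/-- weight towards the centre -/
noncomputable def wC (d s i : ℕ) : ℝ := if i = s + 1 ∨ i = s + 3 ∨ d + 1 ≤ i then 1 else 0
/-- weight towards the predecessor -/
noncomputable def wL (d s i : ℕ) : ℝ :=
  if i = s then 9 / 5 else if i < s ∨ (s + 4 < i ∧ i ≤ d) then 9 / 4 else 0
/-- weight towards the successor -/
noncomputable def wR (d s i : ℕ) : ℝ :=
  if i = s + 4 then 9 / 5 else if i < s ∨ (s + 4 < i ∧ i ≤ d) then 9 / 4 else 0
/-- total weight of an ordered pair -/
noncomputable def wP (d s i j : ℕ) : ℝ :=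
  (if j = s + 2 then wC d s i else 0) + (if j + 1 = i then wL d s i else 0)
    + (if j = i + 1 then wR d s i else 0)

theorem wC_nonneg (d s i : ℕ) : 0 ≤ wC d s i := by unfold wC; split_ifs <;> norm_num
theorem wL_nonneg (d s i : ℕ) : 0 ≤ wL d s i := by unfold wL; split_ifs <;> norm_num
theorem wR_nonneg (d s i : ℕ) : 0 ≤ wR d s i := by unfold wR; split_ifs <;> norm_num
theorem wP_nonneg (d s i j : ℕ) : 0 ≤ wP d s i j := by
  have := wC_nonneg d s i
  have := wL_nonneg d s i
  have := wR_nonneg d s i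
  unfold wP
  split_ifs <;> linarith

/-- left block -/
def inA (d s a i : ℕ) : Prop := i = s ∨ i = s + 1 ∨ (d + 1 ≤ i ∧ i ≤ d + a)
/-- right block -/
def inB (d s a i : ℕ) : Prop := i = s + 3 ∨ i = s + 4 ∨ d + a + 1 ≤ i

/-- generating relation of the graph -/
def relH (d s a i j : ℕ) : Prop :=
  (i + 1 = j ∧ j ≤ d) ∨
    (d + 1 ≤ i ∧ i ≤ d + a ∧ d + 1 ≤ j ∧ j ≤ d + a) ∨
    (d + a + 1 ≤ i ∧ d + a + 1 ≤ j) ∨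
    (d + 1 ≤ i ∧ i ≤ d + a ∧ (j = s ∨ j = s + 1 ∨ j = s + 2)) ∨
    (d + a + 1 ≤ i ∧ (j = s + 2 ∨ j = s + 3 ∨ j = s + 4))

theorem rel_cases (d s a i j : ℕ) (hd : s + 5 ≤ d) (h : relH d s a i j) :
    (inA d s a i ∧ inA d s a j) ∨ (inB d s a i ∧ inB d s a j) ∨
    (j = s + 2 ∧ wC d s i = 1) ∨ (i = s + 2 ∧ wC d s j = 1) ∨
    (i + 1 = j ∧ ((wR d s i = 9 / 4 ∧ wL d s j = 9 / 4) ∨ (wR d s i = 9 / 5 ∧ wL d s j = 9 / 4) ∨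
      (wR d s i = 9 / 4 ∧ wL d s j = 9 / 5))) := by
  unfold relH at h
  unfold inA inB wC wR wL
  rcases h with h | h | h | h | h
  · obtain ⟨rfl, h⟩ := h
    rcases lt_trichotomy (i + 1) s with h1 | h1 | h1
    · right; right; right; right
      refine ⟨rfl, Or.inl ?_⟩
      simp [show i ≠ s + 4 by omega, show i < s by omega, show i + 1 ≠ s by omega, h1]
    · right; right; right; right
      refine ⟨rfl, Or.inr (Or.inr ?_)⟩
      simp [show i ≠ s + 4 by omega, show i < s by omega, h1]
    · by_cases h2 : i < s + 4
      · obtain h3 | h3 | h3 | h3 : i = s ∨ i = s + 1 ∨ i = s + 2 ∨ i = s + 3 := by omega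
        all_goals subst h3; simp
      · right; right; right; right
        refine ⟨rfl, ?_⟩
        by_cases h3 : i = s + 4
        · refine Or.inr (Or.inl ?_)
          subst h3
          simp [show s + 4 + 1 ≠ s by omega, h]
        · refine Or.inl ?_
          simp [h3, show s + 4 < i by omega, show i ≤ d by omega, show i + 1 ≠ s by omega,
            show s + 4 < i + 1 by omega, h]
  · left; omega
  · right; left; omega
  · rcases h with ⟨h1, h2, h3 | h3 | h3⟩
    · left; omega
    · left; omega
    · right; right; left
      exact ⟨h3, if_pos (by omega)⟩
  · rcases h with ⟨h1, h3 | h3 | h3⟩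
    · right; right; left
      exact ⟨h3, if_pos (by omega)⟩
    · right; left; omega
    · right; left; omega

open Classical in
theorem rel_bound (d s a i j : ℕ) (hd : s + 5 ≤ d) (h : relH d s a i j) (x : ℕ → ℝ)
    (hx : x (s + 2) = 0) :
    (x i - x j) ^ 2 ≤ (if inA d s a i ∧ inA d s a j then (x i - x j) ^ 2 else 0)
      + (if inB d s a i ∧ inB d s a j then (x i - x j) ^ 2 else 0)
      + (wP d s i j * x i ^ 2 + wP d s j i * x j ^ 2) := by
  have n1 : 0 ≤ (if inA d s a i ∧ inA d s a j then (x i - x j) ^ 2 else 0) := by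
    split_ifs <;> positivity
  have n2 : 0 ≤ (if inB d s a i ∧ inB d s a j then (x i - x j) ^ 2 else 0) := by
    split_ifs <;> positivity
  have n3 := mul_nonneg (wP_nonneg d s i j) (sq_nonneg (x i))
  have n4 := mul_nonneg (wP_nonneg d s j i) (sq_nonneg (x j))
  have cL := wL_nonneg d s
  have cR := wR_nonneg d s
  have cC := wC_nonneg d s
  rcases rel_cases d s a i j hd h with h | h | ⟨h1, h2⟩ | ⟨h1, h2⟩ | ⟨h1, h2⟩
  · rw [if_pos h]; linarith
  · rw [if_pos h] at *; linarith
  · have : 1 ≤ wP d s i j := by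
      have := cL i
      have := cR i
      unfold wP
      rw [if_pos h1, h2]
      split_ifs <;> linarith
    subst h1
    rw [hx] at *
    nlinarith [mul_le_mul_of_nonneg_right this (sq_nonneg (x i))]
  · have : 1 ≤ wP d s j i := by
      have := cL j
      have := cR j
      unfold wP
      rw [if_pos h1, h2]
      split_ifs <;> linarith
    subst h1
    rw [hx] at *
    nlinarith [mul_le_mul_of_nonneg_right this (sq_nonneg (x j))]
  · have k1 : wR d s i ≤ wP d s i j := by
      have := cL i
      have := cC i
      unfold wP
      rw [if_pos h1.symm]
      split_ifs <;> linarith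
    have k2 : wL d s j ≤ wP d s j i := by
      have := cR j
      have := cC j
      unfold wP
      rw [if_pos h1]
      split_ifs <;> linarith
    have m1 := mul_le_mul_of_nonneg_right k1 (sq_nonneg (x i))
    have m2 := mul_le_mul_of_nonneg_right k2 (sq_nonneg (x j))
    rcases h2 with ⟨e1, e2⟩ | ⟨e1, e2⟩ | ⟨e1, e2⟩ <;> rw [e1] at m1 <;> rw [e2] at m2
    · nlinarith [sq_nonneg (x i + x j), sq_nonneg (x i), sq_nonneg (x j)]
    · nlinarith [sq_nonneg (4 * x i + 5 * x j)]
    · nlinarith [sq_nonneg (5 * x i + 4 * x j)]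

theorem row_sum_aux (n d s i : ℕ) :
    ∑ j : Fin n, wP d s i j ≤ wC d s i + wL d s i + wR d s i := by
  have key : ∀ (P : ℕ → Prop) [DecidablePred P] (w : ℝ), 0 ≤ w →
      (∀ j k, P j → P k → j = k) → ∑ j : Fin n, (if P j then w else 0) ≤ w := by
    intro P _ w hw hP
    rw [← Finset.sum_filter, Finset.sum_const, nsmul_eq_mul]
    have : (Finset.univ.filter (fun j : Fin n => P j)).card ≤ 1 := by
      rw [Finset.card_le_one]
      intro u hu v hv
      simp at hu hv
      exact Fin.ext (hP _ _ hu hv)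
    have : ((Finset.univ.filter (fun j : Fin n => P j)).card : ℝ) ≤ 1 := by exact_mod_cast this
    nlinarith
  unfold wP
  rw [Finset.sum_add_distrib, Finset.sum_add_distrib]
  have h1 := key (fun j => j = s + 2) _ (wC_nonneg d s i) (by intros; omega)
  have h2 := key (fun j => j + 1 = i) _ (wL_nonneg d s i) (by intros; omega)
  have h3 := key (fun j => j = i + 1) _ (wR_nonneg d s i) (by intros; omega)
  linarith

open Classical in
theorem coef_bound (d s a b i : ℕ) (hd : s + 5 ≤ d) (ha : 1 ≤ a) (hb : 1 ≤ b) :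
    (if inA d s a i then (a : ℝ) + 2 else 0) + (if inB d s a i then (b : ℝ) + 2 else 0)
      + (wC d s i + wL d s i + wR d s i) ≤ (a : ℝ) + b + 3 - 1 / 5 := by
  have ha' : (1 : ℝ) ≤ a := by exact_mod_cast ha
  have hb' : (1 : ℝ) ≤ b := by exact_mod_cast hb
  unfold inA inB wC wL wR
  split_ifs <;> first | (exfalso; omega) | linarith

open Classical in
theorem form_bound (n d s a b : ℕ) (hd : s + 5 ≤ d) (ha : 1 ≤ a) (hb : 1 ≤ b)
    (hab : a + b + d + 1 = n) (x : Fin n → ℝ) (hx : x ⟨s + 2, by omega⟩ = 0) (hne : x ≠ 0) :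
    x ⬝ᵥ (lapMat (Hab n d (s + 3) a) *ᵥ x) < ((a : ℝ) + b + 3) * (x ⬝ᵥ x) := by
  set y : ℕ → ℝ := fun k => if h : k < n then x ⟨k, h⟩ else 0 with hy
  have yx : ∀ i : Fin n, y i = x i := by intro i; simp [hy]
  have hy0 : y (s + 2) = 0 := by
    have := yx ⟨s + 2, by omega⟩
    rw [hx] at this; exact this
  set A : Finset (Fin n) := Finset.univ.filter (fun i => inA d s a i) with hA
  set B : Finset (Fin n) := Finset.univ.filter (fun i => inB d s a i) with hB
  have cA : (A.card : ℝ) ≤ (a : ℝ) + 2 := by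
    have : A.card ≤ ({s, s + 1} ∪ Finset.Icc (d + 1) (d + a) : Finset ℕ).card := by
      apply Finset.card_le_card_of_injOn (fun i => i.val)
      · intro i hi
        simp [hA, inA] at hi
        simp
        tauto
      · intro i _ j _ h; exact Fin.ext h
    have h2 := Finset.card_union_le ({s, s + 1} : Finset ℕ) (Finset.Icc (d + 1) (d + a))
    have h3 := Finset.card_le_two (a := s) (b := s + 1)
    have h4 : (Finset.Icc (d + 1) (d + a)).card = a := by simp
    have : A.card ≤ a + 2 := by omega
    exact_mod_cast this
  have cB : (B.card : ℝ) ≤ (b : ℝ) + 2 := by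
    have : B.card ≤ ({s + 3, s + 4} ∪ Finset.Ico (d + a + 1) n : Finset ℕ).card := by
      apply Finset.card_le_card_of_injOn (fun i => i.val)
      · intro i hi
        have := i.isLt
        simp [hB, inB] at hi
        simp
        tauto
      · intro i _ j _ h; exact Fin.ext h
    have h2 := Finset.card_union_le ({s + 3, s + 4} : Finset ℕ) (Finset.Ico (d + a + 1) n)
    have h3 := Finset.card_le_two (a := s + 3) (b := s + 4)
    have h4 : (Finset.Ico (d + a + 1) n).card = b := by simp; omega
    have : B.card ≤ b + 2 := by omega
    exact_mod_cast this
  have hq : x ⬝ᵥ (lapMat (Hab n d (s + 3) a) *ᵥ x)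
      = (∑ i, ∑ j, if (Hab n d (s + 3) a).Adj i j then (x i - x j) ^ 2 else 0) / 2 := by
    have := SimpleGraph.lapMatrix_toLinearMap₂' ℝ (Hab n d (s + 3) a) x
    rw [Matrix.toLinearMap₂'_apply'] at this
    unfold lapMat
    convert this
  have pw : ∀ i j : Fin n, (if (Hab n d (s + 3) a).Adj i j then (x i - x j) ^ 2 else 0)
      ≤ (if i ∈ A ∧ j ∈ A then (x i - x j) ^ 2 else 0)
      + (if i ∈ B ∧ j ∈ B then (x i - x j) ^ 2 else 0)
      + (wP d s i j * x i ^ 2 + wP d s j i * x j ^ 2) := by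
    intro i j
    have n3 := mul_nonneg (wP_nonneg d s i j) (sq_nonneg (x i))
    have n4 := mul_nonneg (wP_nonneg d s j i) (sq_nonneg (x j))
    by_cases h : (Hab n d (s + 3) a).Adj i j
    · rw [if_pos h]
      have h' : relH d s a i j ∨ relH d s a j i := by
        have := ((SimpleGraph.fromRel_adj _ _ _).mp h).2
        simpa [relH] using this
      simp only [hA, hB, Finset.mem_filter, Finset.mem_univ, true_and]
      rcases h' with h' | h'
      · have := rel_bound d s a i j hd h' y hy0
        simpa only [yx] using this
      · have := rel_bound d s a j i hd h' y hy0
        simp only [yx] at this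
        rw [show (x i - x j) ^ 2 = (x j - x i) ^ 2 by ring]
        simp only [and_comm (a := inA d s a i), and_comm (a := inB d s a i)]
        linarith
    · rw [if_neg h]
      have n1 : 0 ≤ (if i ∈ A ∧ j ∈ A then (x i - x j) ^ 2 else 0) := by
        split_ifs <;> positivity
      have n2 : 0 ≤ (if i ∈ B ∧ j ∈ B then (x i - x j) ^ 2 else 0) := by
        split_ifs <;> positivity
      linarith
  have tot := Finset.sum_le_sum fun i (_ : i ∈ Finset.univ) =>
    Finset.sum_le_sum fun j (_ : j ∈ Finset.univ) => pw i j
  simp only [Finset.sum_add_distrib] at tot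
  have sA := clique_sum_aux A x _ cA
  have sB := clique_sum_aux B x _ cB
  have sw : ∑ i : Fin n, ∑ j : Fin n, wP d s i j * x i ^ 2
      ≤ ∑ i : Fin n, (wC d s i + wL d s i + wR d s i) * x i ^ 2 := by
    apply Finset.sum_le_sum
    intro i _
    rw [← Finset.sum_mul]
    exact mul_le_mul_of_nonneg_right (row_sum_aux n d s i) (sq_nonneg _)
  have sw' : ∑ i : Fin n, ∑ j : Fin n, wP d s j i * x j ^ 2
      = ∑ i : Fin n, ∑ j : Fin n, wP d s i j * x i ^ 2 := Finset.sum_comm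
  have fin : ∑ i, (if i ∈ A then (a : ℝ) + 2 else 0) * x i ^ 2
      + ∑ i, (if i ∈ B then (b : ℝ) + 2 else 0) * x i ^ 2
      + ∑ i : Fin n, (wC d s i + wL d s i + wR d s i) * x i ^ 2
      ≤ ((a : ℝ) + b + 3 - 1 / 5) * ∑ i, x i ^ 2 := by
    rw [← Finset.sum_add_distrib, ← Finset.sum_add_distrib, Finset.mul_sum]
    apply Finset.sum_le_sum
    intro i _
    rw [← add_mul, ← add_mul]
    apply mul_le_mul_of_nonneg_right _ (sq_nonneg _)
    have := coef_bound d s a b i hd ha hb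
    simpa only [hA, hB, Finset.mem_filter, Finset.mem_univ, true_and] using this
  have pos : 0 < ∑ i, x i ^ 2 := by
    obtain ⟨i, hi⟩ := Function.ne_iff.mp hne
    exact Finset.sum_pos' (fun i _ => sq_nonneg _) ⟨i, Finset.mem_univ _, by
      have : x i ≠ 0 := hi
      positivity⟩
  have dd : x ⬝ᵥ x = ∑ i, x i ^ 2 := by simp [dotProduct, sq]
  rw [hq, dd]
  linarith

theorem Hab_eigenvalue_bound (n d t a b : ℕ) (ht : 3 ≤ t) (ht' : t + 2 ≤ d)
    (hdn : d + 3 ≤ n) (ha : 1 ≤ a) (hb : 1 ≤ b) (hab : a + b + d + 1 = n) :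
    lapμ (Hab n d t a) (n - d) < (n : ℝ) - d + 2 := by
  obtain ⟨s, rfl⟩ : ∃ s, t = s + 3 := ⟨t - 3, by omega⟩
  have hc : (n : ℝ) - d + 2 = (a : ℝ) + b + 3 := by
    rw [← hab]; push_cast; ring
  rw [hc]
  by_contra hcon
  push Not at hcon
  have hM : (lapMat (Hab n d (s + 3) a)).IsHermitian := by
    unfold lapMat
    letI := Classical.decRel (Hab n d (s + 3) a).Adj
    exact SimpleGraph.isHermitian_lapMatrix ℝ _
  unfold lapμ kthEig heigList at hcon
  rw [dif_pos hM] at hcon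
  obtain ⟨i, j, hij, hi, hj⟩ := two_big_aux _ _ (by omega) _ (by positivity) hcon
  exact form_contra_aux _ hM _ ⟨s + 2, by omega⟩
    (fun x hx hne => form_bound n d s a b (by omega) ha hb hab x hx hne) i j hij hi hj
end
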